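/- arXiv:1005.0672 — 2 statements merged into one kernel-verified Lean document; each statement's English description precedes it below -/
import Mathlib

section
/- Let p be a prime. Identify binary cubic forms over ℤ/p²ℤ with quadruples (a,b,c,d) ∈ (ℤ/p²ℤ)⁴, with GL₂(ℤ/p²ℤ) acting by the twisted action (γ·f)(x,y) = (det γ)⁻¹·f((x,y)·γ). Say f ∈ U_p if f is not ≡ 0 modulo p and there is no γ ∈ GL₂(ℤ/p²ℤ) such that the coefficients a′, b′ of x³ and x²y in γ·f satisfy a′ = 0 in ℤ/p²ℤ and b′ ≡ 0 modulo p; say f ∈ V_p if moreover the reduction of f modulo p does not have a triple root in ℙ¹(𝔽_p). Then #U_p = p³(p³−1)(p²−1) and #V_p = p⁴(p²−1)². -/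
/-- The homogeneous polynomial associated to a binary cubic form over a commutative ring. -/
noncomputable def toPoly {A : Type*} [CommRing A] (f : A × A × A × A) :
    MvPolynomial (Fin 2) A :=
  MvPolynomial.C f.1 * MvPolynomial.X 0 ^ 3 +
    MvPolynomial.C f.2.1 * MvPolynomial.X 0 ^ 2 * MvPolynomial.X 1 +
    MvPolynomial.C f.2.2.1 * MvPolynomial.X 0 * MvPolynomial.X 1 ^ 2 +
    MvPolynomial.C f.2.2.2 * MvPolynomial.X 1 ^ 3

/-- `ActsTo γ f g` means `g = γ · f` under the twisted action
`(γ · f)(x,y) = (det γ)⁻¹ · f((x,y)·γ)`, expressed without inverses as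
`(det γ) · (γ·f)(x,y) = f((x,y)·γ)`. -/
def ActsTo {A : Type*} [CommRing A] (γ : Matrix (Fin 2) (Fin 2) A)
    (f g : A × A × A × A) : Prop :=
  MvPolynomial.C γ.det * toPoly g =
    MvPolynomial.bind₁
      (fun j : Fin 2 =>
        MvPolynomial.C (γ 0 j) * MvPolynomial.X 0 + MvPolynomial.C (γ 1 j) * MvPolynomial.X 1)
      (toPoly f)

/-- Reduction from `ℤ/p²ℤ` to `ℤ/pℤ`. -/
noncomputable def redp (p : ℕ) (x : ZMod (p ^ 2)) : ZMod p :=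
  ZMod.castHom (dvd_pow_self p two_ne_zero) (ZMod p) x

/-- The set `U_p` of binary cubic forms over `ℤ/p²ℤ`: forms that are nonzero mod `p`
and have no `GL₂(ℤ/p²ℤ)`-transform whose `x³`-coefficient is `0` in `ℤ/p²ℤ` and whose
`x²y`-coefficient is `≡ 0 (mod p)`. -/
noncomputable def InU (p : ℕ)
    (f : ZMod (p ^ 2) × ZMod (p ^ 2) × ZMod (p ^ 2) × ZMod (p ^ 2)) : Prop :=
  (redp p f.1, redp p f.2.1, redp p f.2.2.1, redp p f.2.2.2) ≠ 0 ∧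
    ¬∃ (γ : Matrix (Fin 2) (Fin 2) (ZMod (p ^ 2)))
        (g : ZMod (p ^ 2) × ZMod (p ^ 2) × ZMod (p ^ 2) × ZMod (p ^ 2)),
        IsUnit γ.det ∧ ActsTo γ f g ∧ g.1 = 0 ∧ redp p g.2.1 = 0

/-- A binary cubic form over `𝔽_p` has a triple root in `ℙ¹(𝔽_p)`: it is a unit
multiple of the cube of a nonzero linear form. -/
noncomputable def HasTripleRoot (p : ℕ) (f : ZMod p × ZMod p × ZMod p × ZMod p) : Prop :=
  ∃ u r s : ZMod p, IsUnit u ∧ (r, s) ≠ (0, 0) ∧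
    toPoly f = MvPolynomial.C u *
      (MvPolynomial.C r * MvPolynomial.X 0 + MvPolynomial.C s * MvPolynomial.X 1) ^ 3

/-- The set `V_p`: elements of `U_p` whose reduction mod `p` has no triple root. -/
noncomputable def InV (p : ℕ)
    (f : ZMod (p ^ 2) × ZMod (p ^ 2) × ZMod (p ^ 2) × ZMod (p ^ 2)) : Prop :=
  InU p f ∧ ¬HasTripleRoot p (redp p f.1, redp p f.2.1, redp p f.2.2.1, redp p f.2.2.2)

/-- Evaluation at `(X, 1)` recovers the coefficients of a binary cubic form. -/
theorem toPoly_injective {A : Type*} [CommRing A] :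
    Function.Injective (toPoly : A × A × A × A → MvPolynomial (Fin 2) A) := by
  rintro ⟨a, b, c, d⟩ ⟨a', b', c', d'⟩ h
  have h' := congrArg
    (MvPolynomial.aeval (![Polynomial.X, 1] : Fin 2 → Polynomial A)) h
  simp only [toPoly, map_add, map_mul, map_pow, MvPolynomial.aeval_X, MvPolynomial.algHom_C,
    Matrix.cons_val_zero, Matrix.cons_val_one, one_pow, mul_one,
    Polynomial.algebraMap_eq] at h'
  have key (n : ℕ) := congrArg (fun q => Polynomial.coeff q n) h'
  have h0 := key 0
  have h1 := key 1
  have h2 := key 2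
  have h3 := key 3
  simp [Polynomial.coeff_X, Polynomial.coeff_C] at h0 h1 h2 h3
  simp [h0, h1, h2, h3]

theorem actsTo_iff {A : Type*} [CommRing A] (γ : Matrix (Fin 2) (Fin 2) A) (a b c d : A)
    (g : A × A × A × A) :
    ActsTo γ (a, b, c, d) g ↔
      γ.det * g.1 = a * γ 0 0 ^ 3 + b * γ 0 0 ^ 2 * γ 0 1 + c * γ 0 0 * γ 0 1 ^ 2 +
        d * γ 0 1 ^ 3 ∧
      γ.det * g.2.1 = 3 * a * γ 0 0 ^ 2 * γ 1 0 +
        b * (2 * γ 0 0 * γ 1 0 * γ 0 1 + γ 0 0 ^ 2 * γ 1 1) +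
        c * (γ 1 0 * γ 0 1 ^ 2 + 2 * γ 0 0 * γ 0 1 * γ 1 1) + 3 * d * γ 0 1 ^ 2 * γ 1 1 ∧
      γ.det * g.2.2.1 = 3 * a * γ 0 0 * γ 1 0 ^ 2 +
        b * (2 * γ 0 0 * γ 1 0 * γ 1 1 + γ 1 0 ^ 2 * γ 0 1) +
        c * (γ 0 0 * γ 1 1 ^ 2 + 2 * γ 1 0 * γ 0 1 * γ 1 1) + 3 * d * γ 0 1 * γ 1 1 ^ 2 ∧
      γ.det * g.2.2.2 = a * γ 1 0 ^ 3 + b * γ 1 0 ^ 2 * γ 1 1 + c * γ 1 0 * γ 1 1 ^ 2 +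
        d * γ 1 1 ^ 3 := by
  have hl : MvPolynomial.C γ.det * toPoly g =
      toPoly (γ.det * g.1, γ.det * g.2.1, γ.det * g.2.2.1, γ.det * g.2.2.2) := by
    simp only [toPoly, map_mul]; ring
  have hr : MvPolynomial.bind₁ (fun j : Fin 2 =>
        MvPolynomial.C (γ 0 j) * MvPolynomial.X 0 + MvPolynomial.C (γ 1 j) * MvPolynomial.X 1)
      (toPoly (a, b, c, d)) = toPoly
      (a * γ 0 0 ^ 3 + b * γ 0 0 ^ 2 * γ 0 1 + c * γ 0 0 * γ 0 1 ^ 2 + d * γ 0 1 ^ 3,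
       3 * a * γ 0 0 ^ 2 * γ 1 0 +
        b * (2 * γ 0 0 * γ 1 0 * γ 0 1 + γ 0 0 ^ 2 * γ 1 1) +
        c * (γ 1 0 * γ 0 1 ^ 2 + 2 * γ 0 0 * γ 0 1 * γ 1 1) + 3 * d * γ 0 1 ^ 2 * γ 1 1,
       3 * a * γ 0 0 * γ 1 0 ^ 2 +
        b * (2 * γ 0 0 * γ 1 0 * γ 1 1 + γ 1 0 ^ 2 * γ 0 1) +
        c * (γ 0 0 * γ 1 1 ^ 2 + 2 * γ 1 0 * γ 0 1 * γ 1 1) + 3 * d * γ 0 1 * γ 1 1 ^ 2,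
       a * γ 1 0 ^ 3 + b * γ 1 0 ^ 2 * γ 1 1 + c * γ 1 0 * γ 1 1 ^ 2 + d * γ 1 1 ^ 3) := by
    simp only [toPoly, map_add, map_mul, map_pow, MvPolynomial.bind₁_X_right,
      MvPolynomial.bind₁_C_right, map_ofNat]
    ring
  rw [ActsTo, hl, hr, toPoly_injective.eq_iff]
  simp only [Prod.mk.injEq]

theorem toPoly_eq_cube_iff {A : Type*} [CommRing A] (a b c d u r s : A) :
    toPoly (a, b, c, d) = MvPolynomial.C u *
      (MvPolynomial.C r * MvPolynomial.X 0 + MvPolynomial.C s * MvPolynomial.X 1) ^ 3 ↔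
    a = u * r ^ 3 ∧ b = 3 * u * r ^ 2 * s ∧ c = 3 * u * r * s ^ 2 ∧ d = u * s ^ 3 := by
  have hr : (MvPolynomial.C u *
      (MvPolynomial.C r * MvPolynomial.X 0 + MvPolynomial.C s * MvPolynomial.X 1) ^ 3 :
        MvPolynomial (Fin 2) A) =
      toPoly (u * r ^ 3, 3 * u * r ^ 2 * s, 3 * u * r * s ^ 2, u * s ^ 3) := by
    simp only [toPoly, map_mul, map_pow, map_ofNat]; ring
  rw [hr, toPoly_injective.eq_iff]
  simp only [Prod.mk.injEq]

/-- The substitution `f(x, y) ↦ f(x, y + t x)`, moving the point `[1 : t]` to `[1 : 0]`. -/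
def shiftForm {A : Type*} [CommRing A] (t : A) : Equiv.Perm (A × A × A × A) where
  toFun f := (f.1 + f.2.1 * t + f.2.2.1 * t ^ 2 + f.2.2.2 * t ^ 3,
    f.2.1 + 2 * f.2.2.1 * t + 3 * f.2.2.2 * t ^ 2, f.2.2.1 + 3 * f.2.2.2 * t, f.2.2.2)
  invFun f := (f.1 - f.2.1 * t + f.2.2.1 * t ^ 2 - f.2.2.2 * t ^ 3,
    f.2.1 - 2 * f.2.2.1 * t + 3 * f.2.2.2 * t ^ 2, f.2.2.1 - 3 * f.2.2.2 * t, f.2.2.2)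
  left_inv f := by ext <;> dsimp only <;> ring
  right_inv f := by ext <;> dsimp only <;> ring

/-- The substitution `f(x, y) ↦ -f(y, x)`, moving the point `[0 : 1]` to `[1 : 0]`. -/
def swapForm {A : Type*} [CommRing A] : Equiv.Perm (A × A × A × A) where
  toFun f := (-f.2.2.2, -f.2.2.1, -f.2.1, -f.1)
  invFun f := (-f.2.2.2, -f.2.2.1, -f.2.1, -f.1)
  left_inv f := by simp
  right_inv f := by simp

/-- A substitution moving a chosen lift of a point of the projective line over `F`
(with `none` the point at infinity) to `[1 : 0]`. -/
def moveForm {A F : Type*} [CommRing A] (σ : F → A) (o : Option F) :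
    Equiv.Perm (A × A × A × A) :=
  o.elim swapForm fun t => shiftForm (σ t)

theorem exists_actsTo_moveForm {A F : Type*} [CommRing A] (σ : F → A) (o : Option F)
    (f : A × A × A × A) :
    ∃ γ : Matrix (Fin 2) (Fin 2) A, IsUnit γ.det ∧ ActsTo γ f (moveForm σ o f) := by
  obtain ⟨a, b, c, d⟩ := f
  cases o with
  | none =>
    refine ⟨!![0, 1; 1, 0], by simp [Matrix.det_fin_two], (actsTo_iff ..).2 ?_⟩
    simp [Matrix.det_fin_two, moveForm, swapForm]
  | some t =>
    refine ⟨!![1, σ t; 0, 1], by simp [Matrix.det_fin_two], (actsTo_iff ..).2 ?_⟩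
    simp [Matrix.det_fin_two, moveForm, shiftForm]
    ring

section Lifting

variable {A F : Type*} [CommRing A] [Field F] {π : A →+* F} {σ : F → A}

theorem isUnit_of_map_ne_zero (hσ : ∀ t, π (σ t) = t)
    (hsq : ∀ x y, π x = 0 → π y = 0 → x * y = 0) {x : A} (hx : π x ≠ 0) : IsUnit x := by
  have h0 : π (x * σ (π x)⁻¹ - 1) = 0 := by simp [hσ, hx]
  have h := hsq _ _ h0 h0
  exact IsUnit.of_mul_eq_one (σ (π x)⁻¹ * (2 - x * σ (π x)⁻¹)) (by linear_combination -h)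

theorem exists_moveForm_of_actsTo (hσ : ∀ t, π (σ t) = t)
    (hsq : ∀ x y, π x = 0 → π y = 0 → x * y = 0) {γ : Matrix (Fin 2) (Fin 2) A}
    {f g : A × A × A × A} (hγ : IsUnit γ.det) (hfg : ActsTo γ f g) (hg : g.1 = 0)
    (hg' : π g.2.1 = 0) :
    ∃ o, (moveForm σ o f).1 = 0 ∧ π (moveForm σ o f).2.1 = 0 := by
  obtain ⟨a, b, c, d⟩ := f
  obtain ⟨h1, h2, -, -⟩ := (actsTo_iff ..).1 hfg
  have hdet : π γ.det ≠ 0 := (hγ.map π).ne_zero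
  rw [Matrix.det_fin_two] at h1 h2 hdet
  generalize γ 0 0 = r at *
  generalize γ 0 1 = s at *
  generalize γ 1 0 = r' at *
  generalize γ 1 1 = s' at *
  rw [hg, mul_zero] at h1
  replace h2 := congrArg π h2
  simp only [map_add, map_mul, map_sub, map_pow, map_ofNat, hg', mul_zero] at h2 hdet
  by_cases hr : π r = 0
  · have hs : π s ≠ 0 := by rintro h; simp [h, hr] at hdet
    have hr' : π r' ≠ 0 := by rintro h; simp [h, hr] at hdet
    have hd : π d = 0 := by
      have := congrArg π h1
      simpa [hr, hs] using this.symm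
    have hc : π c = 0 := by simpa [hr, hd, hs, hr'] using h2.symm
    have hrr := hsq r r hr hr
    have hcr := hsq c r hc hr
    have hd0 : s ^ 3 * d = 0 := by
      linear_combination -h1 - (a * r + b * s) * hrr - s ^ 2 * hcr
    refine ⟨none, ?_, ?_⟩
    · simpa [moveForm, swapForm] using
        (((isUnit_of_map_ne_zero hσ hsq hs).pow 3).mul_right_eq_zero).1 hd0
    · simpa [moveForm, swapForm] using hc
  · obtain ⟨v, hv⟩ := (isUnit_of_map_ne_zero hσ hsq hr).exists_right_inv
    set w := s * v with hw
    have hs : s = r * w := by linear_combination (-s) * hv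
    have hfw : a + b * w + c * w ^ 2 + d * w ^ 3 = 0 := by
      have : r ^ 3 * (a + b * w + c * w ^ 2 + d * w ^ 3) = 0 := by
        rw [hs] at h1; linear_combination -h1
      exact (((isUnit_of_map_ne_zero hσ hsq hr).pow 3).mul_right_eq_zero).1 this
    have hdw : π b + 2 * π c * π w + 3 * π d * π w ^ 2 = 0 := by
      have hπ := congrArg π hfw
      simp only [map_add, map_mul, map_pow, map_zero] at hπ
      rw [hs] at h2 hdet
      simp only [map_mul] at h2 hdet
      have : (π r * π s' - π r * π w * π r') * π r *
          (π b + 2 * π c * π w + 3 * π d * π w ^ 2) = 0 := by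
        linear_combination -h2 - 3 * π r ^ 2 * π r' * hπ
      simpa [hdet, hr] using this
    have he : π (w - σ (π w)) = 0 := by simp [hσ]
    have hdt : π (b + 2 * c * σ (π w) + 3 * d * σ (π w) ^ 2) = 0 := by
      simpa [hσ, map_ofNat] using hdw
    refine ⟨some (π w), ?_, hdt⟩
    change a + b * σ (π w) + c * σ (π w) ^ 2 + d * σ (π w) ^ 3 = 0
    generalize σ (π w) = t at *
    linear_combination hfw - hsq _ _ he hdt - (c + 3 * d * t + d * (w - t)) * hsq _ _ he he

/-- The forms with a multiple root at `[1 : 0]`, but nonzero, after reduction. -/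
def MultipleRootAtOrigin (π : A →+* F) : Set (A × A × A × A) :=
  {f | π f.1 = 0 ∧ π f.2.1 = 0 ∧ ¬(π f.2.2.1 = 0 ∧ π f.2.2.2 = 0)}

theorem moveForm_index_unique (hσ : ∀ t, π (σ t) = t) {f : A × A × A × A} {o o' : Option F}
    (h : moveForm σ o f ∈ MultipleRootAtOrigin π)
    (h' : moveForm σ o' f ∈ MultipleRootAtOrigin π) : o = o' := by
  obtain ⟨a, b, c, d⟩ := f
  rcases o with _ | t <;> rcases o' with _ | t'
  · rfl
  · simp only [MultipleRootAtOrigin, moveForm, swapForm, shiftForm, Option.elim, Set.mem_ofPred_eq,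
      Equiv.coe_fn_mk, map_add, map_mul, map_pow, map_neg, neg_eq_zero, hσ, map_ofNat] at h h'
    exact absurd ⟨by simp [h.1, h.2.1], h.1⟩ h'.2.2
  · simp only [MultipleRootAtOrigin, moveForm, swapForm, shiftForm, Option.elim, Set.mem_ofPred_eq,
      Equiv.coe_fn_mk, map_add, map_mul, map_pow, map_neg, neg_eq_zero, hσ, map_ofNat] at h h'
    exact absurd ⟨by simp [h'.1, h'.2.1], h'.1⟩ h.2.2
  · simp only [MultipleRootAtOrigin, moveForm, shiftForm, Option.elim, Set.mem_ofPred_eq,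
      Equiv.coe_fn_mk, map_add, map_mul, map_pow, hσ, map_ofNat] at h h'
    obtain ⟨h1, h2, h3⟩ := h
    obtain ⟨h1', h2', -⟩ := h'
    by_contra hne
    have hs : t' - t ≠ 0 := fun e => hne (by rw [sub_eq_zero.1 e])
    have hd : π d = 0 := by
      have : (t' - t) ^ 3 * π d = 0 := by
        linear_combination (t' - t) * h2' + (t' - t) * h2 - 2 * h1' + 2 * h1
      simpa [hs] using this
    have hc : π c = 0 := by
      have : (t' - t) ^ 2 * π c = 0 := by
        rw [hd] at h1 h2 h1' h2'
        linear_combination h1' - h1 - (t' - t) * h2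
      simpa [hs] using this
    exact h3 ⟨by simp [hc, hd], hd⟩

theorem map_moveForm_eq_zero_iff (o : Option F) (f : A × A × A × A) :
    (π (moveForm σ o f).1 = 0 ∧ π (moveForm σ o f).2.1 = 0 ∧ π (moveForm σ o f).2.2.1 = 0 ∧
      π (moveForm σ o f).2.2.2 = 0) ↔
    (π f.1 = 0 ∧ π f.2.1 = 0 ∧ π f.2.2.1 = 0 ∧ π f.2.2.2 = 0) := by
  cases o with
  | none => simp only [moveForm, swapForm, Option.elim, Equiv.coe_fn_mk, map_neg, neg_eq_zero]; tauto
  | some t =>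
    simp only [moveForm, shiftForm, Option.elim, Equiv.coe_fn_mk, map_add, map_mul, map_pow]
    constructor
    · rintro ⟨h1, h2, h3, h4⟩
      simp_all
    · rintro ⟨h1, h2, h3, h4⟩
      simp_all

theorem exists_cube_iff (hσ : ∀ t, π (σ t) = t) (f : A × A × A × A) :
    (∃ u r s : F, IsUnit u ∧ (r, s) ≠ (0, 0) ∧
      toPoly (π f.1, π f.2.1, π f.2.2.1, π f.2.2.2) = MvPolynomial.C u *
        (MvPolynomial.C r * MvPolynomial.X 0 + MvPolynomial.C s * MvPolynomial.X 1) ^ 3) ↔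
    ∃ o, π (moveForm σ o f).1 = 0 ∧ π (moveForm σ o f).2.1 = 0 ∧
      π (moveForm σ o f).2.2.1 = 0 ∧ π (moveForm σ o f).2.2.2 ≠ 0 := by
  obtain ⟨a, b, c, d⟩ := f
  simp only [toPoly_eq_cube_iff, isUnit_iff_ne_zero]
  constructor
  · rintro ⟨u, r, s, hu, hrs, ha, hb, hc, hd⟩
    by_cases hs : s = 0
    · subst hs
      have hr : r ≠ 0 := by simpa using hrs
      refine ⟨none, ?_⟩
      simp [moveForm, swapForm, ha, hb, hc, hd, hu, hr]
    · refine ⟨some (-r / s), ?_⟩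
      simp only [moveForm, shiftForm, Option.elim, Equiv.coe_fn_mk, map_add, map_mul, map_pow, hσ,
        map_ofNat, ha, hb, hc, hd]
      refine ⟨?_, ?_, ?_, by simp [hu, hs]⟩ <;> field_simp <;> ring
  · rintro ⟨_ | t, h1, h2, h3, h4⟩
    · simp only [moveForm, swapForm, Option.elim, Equiv.coe_fn_mk, map_neg, neg_eq_zero,
        ne_eq] at h1 h2 h3 h4
      exact ⟨π a, 1, 0, h4, by simp, by simp, by simp [h3], by simp [h2], by simp [h1]⟩
    · simp only [moveForm, shiftForm, Option.elim, Equiv.coe_fn_mk, map_add, map_mul, map_pow, hσ,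
        map_ofNat] at h1 h2 h3 h4
      refine ⟨π d, -t, 1, h4, by simp, ?_, ?_, ?_, by simp⟩
      · linear_combination h1 - t * h2 + t ^ 2 * h3
      · linear_combination h2 - 2 * t * h3
      · linear_combination h3

theorem ncard_exists_moveForm_mem [Finite F] (hσ : ∀ t, π (σ t) = t)
    {S : Set (A × A × A × A)} (hS : S ⊆ MultipleRootAtOrigin π) :
    {f | ∃ o, moveForm σ o f ∈ S}.ncard = (Nat.card F + 1) * S.ncard := by
  let φ : Option F × S → {f | ∃ o, moveForm σ o f ∈ S} := fun x =>
    ⟨(moveForm σ x.1).symm x.2, x.1, by simp⟩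
  have hφ : φ.Bijective := by
    constructor
    · rintro ⟨o, g, hg⟩ ⟨o', g', hg'⟩ h
      have h' : (moveForm σ o).symm g = (moveForm σ o').symm g' := congrArg Subtype.val h
      have ho : o = o' := moveForm_index_unique (f := (moveForm σ o).symm g) hσ
        (hS (by simpa using hg)) (hS (by rw [h']; simpa using hg'))
      subst ho
      simpa using h'
    · rintro ⟨f, o, h⟩
      exact ⟨(o, ⟨_, h⟩), by simp [φ]⟩
  rw [← Nat.card_coe_set_eq, ← Nat.card_congr (Equiv.ofBijective φ hφ), Nat.card_prod,
    Finite.card_option, Nat.card_coe_set_eq]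

theorem card_eq_card_mul_ncard_ker (hσ : ∀ t, π (σ t) = t) :
    Nat.card A = Nat.card F * {x | π x = 0}.ncard := by
  let e : A ≃ F × {x | π x = 0} :=
    { toFun := fun x => (π x, ⟨x - σ (π x), by simp [hσ]⟩)
      invFun := fun y => σ y.1 + y.2
      left_inv := fun x => by simp
      right_inv := by rintro ⟨t, x, hx : π x = 0⟩; simp [hσ, hx] }
  rw [Nat.card_congr e, Nat.card_prod, Nat.card_coe_set_eq]

end Lifting

theorem redp_mul_eq_zero {p : ℕ} (hp : p.Prime) {x y : ZMod (p ^ 2)} (hx : redp p x = 0)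
    (hy : redp p y = 0) : x * y = 0 := by
  have : NeZero (p ^ 2) := ⟨pow_ne_zero 2 hp.ne_zero⟩
  have key (z : ZMod (p ^ 2)) (hz : redp p z = 0) : p ∣ z.val := by
    rw [← ZMod.natCast_eq_zero_iff]
    rwa [redp, ← ZMod.natCast_zmod_val z, map_natCast] at hz
  rw [← ZMod.natCast_zmod_val x, ← ZMod.natCast_zmod_val y, ← Nat.cast_mul,
    ZMod.natCast_eq_zero_iff]
  exact (sq p).dvd.trans (mul_dvd_mul (key x hx) (key y hy))

theorem card_U_and_V (p : ℕ) (hp : p.Prime) :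
    Nat.card { f : ZMod (p ^ 2) × ZMod (p ^ 2) × ZMod (p ^ 2) × ZMod (p ^ 2) // InU p f } =
        p ^ 3 * (p ^ 3 - 1) * (p ^ 2 - 1) ∧
    Nat.card { f : ZMod (p ^ 2) × ZMod (p ^ 2) × ZMod (p ^ 2) × ZMod (p ^ 2) // InV p f } =
        p ^ 4 * (p ^ 2 - 1) ^ 2 := by
  have : Fact p.Prime := ⟨hp⟩
  have : NeZero (p ^ 2) := ⟨pow_ne_zero 2 hp.ne_zero⟩
  let π : ZMod (p ^ 2) →+* ZMod p := ZMod.castHom (dvd_pow_self p two_ne_zero) (ZMod p)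
  obtain ⟨σ, hσ⟩ : ∃ σ : ZMod p → ZMod (p ^ 2), ∀ t, π (σ t) = t :=
    (ZMod.castHom_surjective (dvd_pow_self p two_ne_zero)).hasRightInverse
  have hsq (x y : ZMod (p ^ 2)) : π x = 0 → π y = 0 → x * y = 0 := redp_mul_eq_zero hp
  set K : Set (ZMod (p ^ 2)) := {x | π x = 0} with hK
  have hKcard : K.ncard = p := by
    have h := card_eq_card_mul_ncard_ker hσ
    rw [Nat.card_zmod, Nat.card_zmod] at h
    exact (Nat.eq_of_mul_eq_mul_left hp.pos ((sq p).symm.trans h)).symm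
  let S₀ : Set (ZMod (p ^ 2) × ZMod (p ^ 2) × ZMod (p ^ 2) × ZMod (p ^ 2)) :=
    {0} ×ˢ K ×ˢ (K ×ˢ K)ᶜ
  let S₁ : Set (ZMod (p ^ 2) × ZMod (p ^ 2) × ZMod (p ^ 2) × ZMod (p ^ 2)) :=
    (K \ {0}) ×ˢ K ×ˢ K ×ˢ Kᶜ
  let Z : Set (ZMod (p ^ 2) × ZMod (p ^ 2) × ZMod (p ^ 2) × ZMod (p ^ 2)) :=
    K ×ˢ K ×ˢ K ×ˢ K
  have hKc : K.ncard + Kᶜ.ncard = p ^ 2 := by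
    rw [Set.ncard_add_ncard_compl, Nat.card_zmod]
  have hKKc : (K ×ˢ K).ncard + (K ×ˢ K)ᶜ.ncard = p ^ 2 * p ^ 2 := by
    rw [Set.ncard_add_ncard_compl, Nat.card_prod, Nat.card_zmod]
  have hKd : (K \ {0}).ncard + 1 = K.ncard :=
    Set.ncard_sdiff_singleton_add_one (by simp [hK]) (Set.toFinite _)
  have hS₀ : S₀ ⊆ MultipleRootAtOrigin π := by
    rintro ⟨a, b, c, d⟩ ⟨ha, hb, hcd⟩
    obtain rfl : a = 0 := ha
    exact ⟨map_zero π, hb, hcd⟩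
  have hS₁ : S₁ ⊆ MultipleRootAtOrigin π := fun f ⟨ha, hb, _, hd⟩ => ⟨ha.1, hb, fun h => hd h.2⟩
  have hU (f) : InU p f ↔ f ∉ Z ∧ ¬∃ o, (moveForm σ o f).1 = 0 ∧ π (moveForm σ o f).2.1 = 0 := by
    refine and_congr ?_ (not_congr ⟨?_, ?_⟩)
    · simp only [ne_eq, Prod.mk_eq_zero]
      rfl
    · rintro ⟨γ, g, hγ, hfg, hg, hg'⟩
      exact exists_moveForm_of_actsTo hσ hsq hγ hfg hg hg'
    · rintro ⟨o, ho⟩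
      obtain ⟨γ, hγ, hfg⟩ := exists_actsTo_moveForm σ o f
      exact ⟨γ, _, hγ, hfg, ho⟩
  have hZ (o f) : moveForm σ o f ∈ Z ↔ f ∈ Z := map_moveForm_eq_zero_iff o f
  have hUc : {f | InU p f}ᶜ = Z ∪ {f | ∃ o, moveForm σ o f ∈ S₀} := by
    ext f
    simp only [Set.mem_compl_iff, Set.mem_ofPred_eq, hU, Set.mem_union, not_and_or, not_not]
    by_cases hf : f ∈ Z
    · simp [hf]
    · simp only [hf, false_or]
      refine exists_congr fun o => ⟨fun h => ⟨h.1, h.2, fun hcd => hf ?_⟩, fun h => ⟨h.1, h.2.1⟩⟩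
      exact (hZ o f).1 ⟨by simp [hK, h.1], h.2, hcd⟩
  have hdisj : Disjoint Z {f | ∃ o, moveForm σ o f ∈ S₀} := by
    rw [Set.disjoint_left]
    rintro f hf ⟨o, ho⟩
    exact ho.2.2 ((hZ o f).2 hf).2.2
  have hUV : {f | InU p f} = {f | InV p f} ∪ {f | ∃ o, moveForm σ o f ∈ S₁} := by
    ext f
    have hT : HasTripleRoot p (redp p f.1, redp p f.2.1, redp p f.2.2.1, redp p f.2.2.2) ↔ _ :=
      exists_cube_iff hσ f
    simp only [Set.mem_ofPred_eq, Set.mem_union, InV, hT]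
    constructor
    · intro h
      by_cases ht : ∃ o, π (moveForm σ o f).1 = 0 ∧ π (moveForm σ o f).2.1 = 0 ∧
        π (moveForm σ o f).2.2.1 = 0 ∧ π (moveForm σ o f).2.2.2 ≠ 0
      · obtain ⟨o, h1, h2, h3, h4⟩ := ht
        exact Or.inr ⟨o, ⟨h1, fun h0 => ((hU f).1 h).2 ⟨o, h0, h2⟩⟩, h2, h3, h4⟩
      · exact Or.inl ⟨h, ht⟩
    · rintro (h | ⟨o, ho⟩)
      · exact h.1
      · have hfZ : f ∉ Z := fun hf => ho.2.2.2 ((hZ o f).2 hf).2.2.2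
        refine (hU f).2 ⟨hfZ, ?_⟩
        rintro ⟨o', h1, h2⟩
        have ho' : o = o' := moveForm_index_unique hσ (hS₁ ho)
          ⟨by rw [h1, map_zero], h2, fun hcd => hfZ ((hZ o' f).1 ⟨by simp [hK, h1], h2, hcd⟩)⟩
        subst ho'
        exact ho.1.2 h1
  have hdisj' : Disjoint {f | InV p f} {f | ∃ o, moveForm σ o f ∈ S₁} := by
    rw [Set.disjoint_left]
    rintro f hf ⟨o, ho⟩
    exact hf.2 ((exists_cube_iff hσ f).2 ⟨o, ho.1.1, ho.2.1, ho.2.2.1, ho.2.2.2⟩)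
  have hcU : {f | InU p f}.ncard + {f | InU p f}ᶜ.ncard = p ^ 2 * (p ^ 2 * (p ^ 2 * p ^ 2)) := by
    rw [Set.ncard_add_ncard_compl, Nat.card_prod, Nat.card_prod, Nat.card_prod, Nat.card_zmod]
  have hcV := congrArg Set.ncard hUV
  rw [hUc, Set.ncard_union_eq hdisj, ncard_exists_moveForm_mem hσ hS₀] at hcU
  rw [Set.ncard_union_eq hdisj', ncard_exists_moveForm_mem hσ hS₁] at hcV
  simp only [S₀, S₁, Z, Set.ncard_prod, Set.ncard_singleton, Nat.card_zmod, hKcard]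
    at hcU hcV hKc hKKc hKd
  change {f | InU p f}.ncard = _ ∧ {f | InV p f}.ncard = _
  have h2 : 1 ≤ p ^ 2 := Nat.one_le_pow _ _ hp.pos
  have h3 : 1 ≤ p ^ 3 := Nat.one_le_pow _ _ hp.pos
  generalize {f | InU p f}.ncard = u at *
  generalize {f | InV p f}.ncard = v at *
  generalize (K ×ˢ K)ᶜ.ncard = m at *
  generalize Kᶜ.ncard = n at *
  generalize (K \ {0}).ncard = k at *
  zify [h2, h3] at *
  have hm : (m : ℤ) = p ^ 4 - p ^ 2 := by linear_combination hKKc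
  have hn : (n : ℤ) = p ^ 2 - p := by linear_combination hKc
  have hk : (k : ℤ) = p - 1 := by linear_combination hKd
  rw [hm] at hcU
  rw [hk, hn] at hcV
  exact ⟨by linear_combination hcU, by linear_combination hcU - hcV⟩
end

section
/- Let n be a squarefree positive integer. For v = (a,b,c,d) ∈ ℤ⁴ let w_n(v) denote the number of points [x:y] ∈ ℙ¹(ℤ/nℤ) with ax³+bx²y+cxy²+dy³ ≡ 0 (mod n). Let 𝓑 ⊂ ℝ⁴ be a box (a product of four intervals) with sides parallel to the coordinate axes, each side of length at most n. Then for every ε > 0, ∑_{v ∈ 𝓑 ∩ ℤ⁴} w_n(v) = (σ(n)/n)·Vol(𝓑) + O_ε(n^{3+ε}), where σ(n) is the sum of the divisors of n and the implied constant depends only on ε. -/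
/-- The projective line over `ℤ/nℤ`: pairs generating the unit ideal, modulo scaling
by units. -/
def ProjLine (n : ℕ) : Type :=
  Quot fun v w : { v : ZMod n × ZMod n // Ideal.span {v.1, v.2} = ⊤ } =>
    ∃ u : (ZMod n)ˣ, w.1.1 = (u : ZMod n) * v.1.1 ∧ w.1.2 = (u : ZMod n) * v.1.2

/-- A representative of a point of the projective line. -/
noncomputable def ProjLine.rep {n : ℕ} (q : ProjLine n) : ZMod n × ZMod n :=
  (Classical.choose (Quot.exists_rep q)).1

/-- Evaluation mod `n` of the integral binary cubic form with coefficients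
`(v 0, v 1, v 2, v 3)` at a pair `(x,y)` over `ℤ/nℤ`. -/
def evalFormZ (n : ℕ) (v : Fin 4 → ℤ) (xy : ZMod n × ZMod n) : ZMod n :=
  (v 0 : ZMod n) * xy.1 ^ 3 + (v 1 : ZMod n) * xy.1 ^ 2 * xy.2 +
    (v 2 : ZMod n) * xy.1 * xy.2 ^ 2 + (v 3 : ZMod n) * xy.2 ^ 3

/-- The number of roots in `ℙ¹(ℤ/nℤ)` of the binary cubic form with integer
coefficients `(v 0, v 1, v 2, v 3)`, reduced mod `n`. -/
noncomputable def wn (n : ℕ) (v : Fin 4 → ℤ) : ℕ :=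
  Nat.card { q : ProjLine n // evalFormZ n v q.rep = 0 }

open Finset

section CRT

variable {n : ℕ}

instance primeFactors_fact (p : n.primeFactors) : Fact (p : ℕ).Prime :=
  ⟨Nat.prime_of_mem_primeFactors p.2⟩

/-- Reduction modulo a prime factor `p` of `n`. -/
def redMod (p : n.primeFactors) : ZMod n →+* ZMod p :=
  ZMod.castHom (Nat.dvd_of_mem_primeFactors p.2) _

theorem redMod_intCast (p : n.primeFactors) (z : ℤ) : redMod p (z : ZMod n) = (z : ZMod p) :=
  map_intCast _ z

theorem redMod_pi_bijective (hn : Squarefree n) :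
    Function.Bijective fun (z : ZMod n) (p : n.primeFactors) => redMod p z := by
  have : NeZero n := ⟨hn.ne_zero⟩
  rw [Fintype.bijective_iff_injective_and_card]
  constructor
  · intro z w h
    rw [← sub_eq_zero]
    have h' : ∀ p : n.primeFactors, redMod p (z - w) = 0 := fun p => by
      rw [map_sub, sub_eq_zero]; exact congrFun h p
    rw [← ZMod.natCast_zmod_val (z - w), ZMod.natCast_eq_zero_iff]
    nth_rewrite 1 [← Nat.prod_primeFactors_of_squarefree hn]
    refine Finset.prod_primes_dvd _ (fun p hp => (Nat.prime_of_mem_primeFactors hp).prime) ?_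
    intro p hp
    have := h' ⟨p, hp⟩
    rwa [← ZMod.natCast_zmod_val (z - w), map_natCast, ZMod.natCast_eq_zero_iff] at this
  · simp only [ZMod.card, Fintype.card_pi]
    rw [Finset.prod_coe_sort n.primeFactors (fun p => p), Nat.prod_primeFactors_of_squarefree hn]

theorem sum_pair_eq_prod [NeZero n] (hn : Squarefree n) {R : Type*} [CommSemiring R]
    (f : ∀ p : n.primeFactors, ZMod p × ZMod p → R) :
    ∑ v : ZMod n × ZMod n, ∏ p, f p (redMod p v.1, redMod p v.2) = ∏ p, ∑ v, f p v := by
  classical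
  rw [Finset.prod_univ_sum, Fintype.piFinset_univ]
  have hb := redMod_pi_bijective hn
  refine Fintype.sum_bijective (fun v p => (redMod p v.1, redMod p v.2)) ⟨?_, ?_⟩ _ _ fun _ => rfl
  · intro v w h
    have h' := fun p => Prod.ext_iff.1 (congrFun h p)
    exact Prod.ext (hb.1 (funext fun p => (h' p).1)) (hb.1 (funext fun p => (h' p).2))
  · intro g
    obtain ⟨x, hx⟩ := hb.2 fun p => (g p).1
    obtain ⟨y, hy⟩ := hb.2 fun p => (g p).2
    exact ⟨(x, y), funext fun p => Prod.ext (congrFun hx p) (congrFun hy p)⟩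

theorem sum_triple_eq_prod [NeZero n] (hn : Squarefree n) {R : Type*} [CommSemiring R]
    (f : ∀ p : n.primeFactors, ZMod p × ZMod p × ZMod p → R) :
    ∑ v : ZMod n × ZMod n × ZMod n, ∏ p, f p (redMod p v.1, redMod p v.2.1, redMod p v.2.2) =
      ∏ p, ∑ v, f p v := by
  classical
  rw [Finset.prod_univ_sum, Fintype.piFinset_univ]
  have hb := redMod_pi_bijective hn
  refine Fintype.sum_bijective (fun v p => (redMod p v.1, redMod p v.2.1, redMod p v.2.2))
    ⟨?_, ?_⟩ _ _ fun _ => rfl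
  · intro v w h
    have h' := fun p => Prod.ext_iff.1 (congrFun h p)
    have h'' := fun p => Prod.ext_iff.1 (h' p).2
    exact Prod.ext (hb.1 (funext fun p => (h' p).1))
      (Prod.ext (hb.1 (funext fun p => (h'' p).1)) (hb.1 (funext fun p => (h'' p).2)))
  · intro g
    obtain ⟨x, hx⟩ := hb.2 fun p => (g p).1
    obtain ⟨y, hy⟩ := hb.2 fun p => (g p).2.1
    obtain ⟨z, hz⟩ := hb.2 fun p => (g p).2.2
    exact ⟨(x, y, z), funext fun p => Prod.ext (congrFun hx p)
      (Prod.ext (congrFun hy p) (congrFun hz p))⟩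

theorem span_pair_eq_top_iff {R : Type*} [CommRing R] (x y : R) :
    Ideal.span {x, y} = ⊤ ↔ IsCoprime x y := by
  rw [Ideal.eq_top_iff_one, Ideal.mem_span_pair]; rfl

theorem isCoprime_iff_redMod (hn : Squarefree n) (x y : ZMod n) :
    IsCoprime x y ↔ ∀ p : n.primeFactors, ¬ (redMod p x = 0 ∧ redMod p y = 0) := by
  constructor
  · rintro h p ⟨hx, hy⟩
    have := h.map (redMod p)
    rw [hx, hy, isCoprime_zero_left] at this
    exact not_isUnit_zero this
  · intro h
    have : ∀ p : n.primeFactors, ∃ a b, a * redMod p x + b * redMod p y = 1 := by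
      intro p
      by_cases hx : redMod p x = 0
      · exact ⟨0, (redMod p y)⁻¹, by
          rw [zero_mul, zero_add, inv_mul_cancel₀ fun hy => h p ⟨hx, hy⟩]⟩
      · exact ⟨(redMod p x)⁻¹, 0, by rw [zero_mul, add_zero, inv_mul_cancel₀ hx]⟩
    choose a b hab using this
    have hb := redMod_pi_bijective hn
    obtain ⟨a', ha'⟩ := hb.2 a
    obtain ⟨b', hb'⟩ := hb.2 b
    refine ⟨a', b', hb.1 (funext fun p => ?_)⟩
    simp only [map_add, map_mul, map_one, ← hab p]
    rw [← congrFun ha' p, ← congrFun hb' p]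

theorem totient_eq_prod_of_squarefree (hn : Squarefree n) :
    (Nat.totient n : ℝ) = ∏ p : n.primeFactors, ((p : ℝ) - 1) := by
  rw [Nat.totient_eq_prod_factorization hn.ne_zero, Finsupp.prod, Nat.support_factorization,
    ← Finset.prod_coe_sort, Nat.cast_prod]
  refine Finset.prod_congr rfl fun p _ => ?_
  have hp := (primeFactors_fact p).out
  rw [Nat.factorization_eq_one_of_squarefree hn hp (Nat.dvd_of_mem_primeFactors p.2)]
  simp [Nat.cast_sub hp.one_le]

theorem sum_divisors_eq_prod_of_squarefree (hn : Squarefree n) :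
    ∑ d ∈ n.divisors, (d : ℝ) = ∏ p : n.primeFactors, ((p : ℝ) + 1) := by
  have h := ArithmeticFunction.isMultiplicative_sigma (k := 1) |>.map_prod_of_subset_primeFactors
    n n.primeFactors subset_rfl
  rw [Nat.prod_primeFactors_of_squarefree hn, ← Finset.prod_coe_sort] at h
  rw [← Nat.cast_sum, ← ArithmeticFunction.sigma_one_apply, h, Nat.cast_prod]
  refine Finset.prod_congr rfl fun p _ => ?_
  have hp := (primeFactors_fact p).out
  rw [ArithmeticFunction.sigma_one_apply, hp.sum_divisors]
  simp

theorem cast_eq_prod_of_squarefree (hn : Squarefree n) :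
    (n : ℝ) = ∏ p : n.primeFactors, (p : ℝ) := by
  rw [Finset.prod_coe_sort n.primeFactors (fun p => (p : ℝ)), ← Nat.cast_prod,
    Nat.prod_primeFactors_of_squarefree hn]

theorem card_divisors_of_squarefree (hn : Squarefree n) :
    (#n.divisors : ℝ) = ∏ _p : n.primeFactors, (2 : ℝ) := by
  rw [Nat.card_divisors hn.ne_zero, ← Finset.prod_coe_sort, Nat.cast_prod]
  refine Finset.prod_congr rfl fun p _ => ?_
  rw [Nat.factorization_eq_one_of_squarefree hn (primeFactors_fact p).out
    (Nat.dvd_of_mem_primeFactors p.2)]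
  norm_num

open Classical in
theorem card_isCoprime [NeZero n] (hn : Squarefree n) :
    (#{v : ZMod n × ZMod n | IsCoprime v.1 v.2} : ℝ) =
      Nat.totient n * ∑ d ∈ n.divisors, (d : ℝ) := by
  rw [totient_eq_prod_of_squarefree hn, sum_divisors_eq_prod_of_squarefree hn,
    ← Finset.prod_mul_distrib]
  rw [Finset.card_filter, Nat.cast_sum]
  have := sum_pair_eq_prod hn (R := ℝ) fun p v => if v.1 = 0 ∧ v.2 = 0 then 0 else 1
  convert this using 2
  · rw [isCoprime_iff_redMod hn]
    split_ifs with h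
    · symm
      push_cast
      exact Finset.prod_eq_one fun p _ => if_neg (h p)
    · push Not at h
      obtain ⟨p, hp⟩ := h
      symm
      push_cast
      exact Finset.prod_eq_zero (Finset.mem_univ p) (if_pos hp)
  · rename_i p _
    have h1 : ∀ v : ZMod p × ZMod p, (if v.1 = 0 ∧ v.2 = 0 then (0 : ℝ) else 1) =
        1 - if v = 0 then 1 else 0 := by
      intro v
      have hv : v = 0 ↔ v.1 = 0 ∧ v.2 = 0 := Prod.ext_iff
      simp only [hv]
      split_ifs <;> norm_num
    simp only [h1, Finset.sum_sub_distrib]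
    simp
    ring

end CRT

section Orbits

variable {n : ℕ}

theorem ProjLine.mk_eq_iff (v w : { v : ZMod n × ZMod n // Ideal.span {v.1, v.2} = ⊤ }) :
    (Quot.mk _ v : ProjLine n) = Quot.mk _ w ↔
      ∃ u : (ZMod n)ˣ, w.1.1 = (u : ZMod n) * v.1.1 ∧ w.1.2 = (u : ZMod n) * v.1.2 := by
  refine ⟨fun h => ?_, fun h => Quot.sound h⟩
  have := Quot.eqvGen_exact h
  rwa [Equivalence.eqvGen_iff] at this
  refine ⟨fun x => ⟨1, by simp⟩, ?_, ?_⟩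
  · rintro x y ⟨u, h1, h2⟩
    exact ⟨u⁻¹, by rw [h1, Units.inv_mul_cancel_left], by rw [h2, Units.inv_mul_cancel_left]⟩
  · rintro x y z ⟨u, h1, h2⟩ ⟨u', h1', h2'⟩
    exact ⟨u' * u, by rw [h1', h1, Units.val_mul, mul_assoc],
      by rw [h2', h2, Units.val_mul, mul_assoc]⟩

theorem ProjLine.isCoprime_rep (q : ProjLine n) : IsCoprime q.rep.1 q.rep.2 :=
  (span_pair_eq_top_iff _ _).1 (Classical.choose (Quot.exists_rep q)).2

/-- Each point of the projective line has exactly `φ(n)` representatives. -/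
theorem card_isCoprime_and [NeZero n] (S : ZMod n × ZMod n → Prop)
    (hS : ∀ (u : (ZMod n)ˣ) (v : ZMod n × ZMod n), S v → S (u * v.1, u * v.2)) :
    Nat.totient n * Nat.card { q : ProjLine n // S q.rep } =
      Nat.card { v : ZMod n × ZMod n // IsCoprime v.1 v.2 ∧ S v } := by
  classical
  rw [← ZMod.card_units_eq_totient, ← Nat.card_eq_fintype_card, ← Nat.card_prod]
  have hcop : ∀ (u : (ZMod n)ˣ) (v : ZMod n × ZMod n), IsCoprime v.1 v.2 →
      IsCoprime ((u : ZMod n) * v.1) (u * v.2) := fun u v h =>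
    (isCoprime_mul_unit_left u.isUnit _ _).2 h
  refine Nat.card_congr (Equiv.ofBijective
    (fun a : (ZMod n)ˣ × { q : ProjLine n // S q.rep } =>
      ⟨(a.1 * a.2.1.rep.1, a.1 * a.2.1.rep.2), hcop _ _ a.2.1.isCoprime_rep, hS _ _ a.2.2⟩)
    ⟨?_, ?_⟩)
  · rintro ⟨u, q, hq⟩ ⟨u', q', hq'⟩ h
    simp only [Subtype.mk.injEq, Prod.mk.injEq] at h
    have hqq : q = q' := by
      rw [← Classical.choose_spec (Quot.exists_rep q), ← Classical.choose_spec (Quot.exists_rep q')]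
      refine (ProjLine.mk_eq_iff _ _).2 ⟨u'⁻¹ * u, ?_, ?_⟩
      · change q'.rep.1 = _ * q.rep.1
        rw [Units.val_mul, mul_assoc, h.1, Units.inv_mul_cancel_left]
      · change q'.rep.2 = _ * q.rep.2
        rw [Units.val_mul, mul_assoc, h.2, Units.inv_mul_cancel_left]
    subst hqq
    obtain ⟨a, b, hab⟩ := q.isCoprime_rep
    have : u = u' := by
      ext
      calc (u : ZMod n) = a * (u * q.rep.1) + b * (u * q.rep.2) := by linear_combination -u * hab
        _ = u' := by rw [h.1, h.2]; linear_combination u' * hab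
    rw [this]
  · rintro ⟨v, hv, hSv⟩
    set w : { v : ZMod n × ZMod n // Ideal.span {v.1, v.2} = ⊤ } :=
      ⟨v, (span_pair_eq_top_iff _ _).2 hv⟩
    set q : ProjLine n := Quot.mk _ w with hq
    obtain ⟨u, h1, h2⟩ := (ProjLine.mk_eq_iff _ _).1 (Classical.choose_spec (Quot.exists_rep q))
    have hrep : q.rep = ((u⁻¹ : (ZMod n)ˣ) * v.1, (u⁻¹ : (ZMod n)ˣ) * v.2) := by
      refine Prod.ext ?_ ?_
      · change _ = _ * w.1.1
        rw [h1, Units.inv_mul_cancel_left]; rfl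
      · change _ = _ * w.1.2
        rw [h2, Units.inv_mul_cancel_left]; rfl
    refine ⟨⟨u, q, ?_⟩, ?_⟩
    · rw [hrep]; exact hS _ _ hSv
    · ext
      · exact h1.symm
      · exact h2.symm

open Classical in
theorem totient_mul_wn [NeZero n] (v : Fin 4 → ℤ) :
    Nat.totient n * wn n v =
      #{xy : ZMod n × ZMod n | IsCoprime xy.1 xy.2 ∧ evalFormZ n v xy = 0} := by
  rw [wn, card_isCoprime_and (S := fun xy => evalFormZ n v xy = 0), Nat.card_eq_fintype_card,
    Fintype.card_subtype]
  intro u xy h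
  have : evalFormZ n v (u * xy.1, u * xy.2) = u ^ 3 * evalFormZ n v xy := by
    simp only [evalFormZ]; ring
  rw [this, h, mul_zero]

end Orbits

section Fourier

variable {n : ℕ}

/-- The absolute least residue, with `0` replaced by `1`. -/
noncomputable def absRes (z : ZMod n) : ℝ := max 1 (z.valMinAbs.natAbs : ℝ)

theorem absRes_pos (z : ZMod n) : 0 < absRes z := lt_max_of_lt_left one_pos

theorem absRes_of_ne_zero {z : ZMod n} (hz : z ≠ 0) : absRes z = z.valMinAbs.natAbs := by
  refine max_eq_right ?_
  have : z.valMinAbs ≠ 0 := (ZMod.valMinAbs_eq_zero z).not.2 hz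
  exact_mod_cast Int.natAbs_pos.2 this

variable [NeZero n]

/-- The exponential sum over the integers of `[a, b]` at the frequency `z / n`. -/
noncomputable def expSum (a b : ℤ) (z : ZMod n) : ℂ :=
  ∑ m ∈ Icc a b, ZMod.stdAddChar ((m : ZMod n) * z)

theorem indicator_eq_sum_stdAddChar (z : ZMod n) :
    (if z = 0 then (1 : ℂ) else 0) = (n : ℂ)⁻¹ * ∑ k : ZMod n, ZMod.stdAddChar (k * z) := by
  rw [AddChar.sum_mulShift z (ZMod.isPrimitive_stdAddChar n), ZMod.card]
  have : (n : ℂ) ≠ 0 := Nat.cast_ne_zero.2 (NeZero.ne n)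
  split_ifs <;> simp [this]

/-- The product of exponential sums attached to the frequency `k` and the point `[x : y]`. -/
noncomputable def expSumProd (a b : Fin 4 → ℤ) (k : ZMod n) (xy : ZMod n × ZMod n) : ℂ :=
  expSum (a 0) (b 0) (k * xy.1 ^ 3) * expSum (a 1) (b 1) (k * (xy.1 ^ 2 * xy.2)) *
    expSum (a 2) (b 2) (k * (xy.1 * xy.2 ^ 2)) * expSum (a 3) (b 3) (k * xy.2 ^ 3)

theorem sum_stdAddChar_evalFormZ (a b : Fin 4 → ℤ) (k : ZMod n) (xy : ZMod n × ZMod n) :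
    ∑ v ∈ Fintype.piFinset fun i => Icc (a i) (b i), ZMod.stdAddChar (k * evalFormZ n v xy) =
      expSumProd a b k xy := by
  have h := Finset.prod_univ_sum (fun i => Icc (a i) (b i)) fun (i : Fin 4) (m : ℤ) =>
    (ZMod.stdAddChar ((m : ZMod n) * (k * ![xy.1 ^ 3, xy.1 ^ 2 * xy.2, xy.1 * xy.2 ^ 2,
      xy.2 ^ 3] i)) : ℂ)
  simp only [Fin.prod_univ_four] at h
  rw [expSumProd]
  simp only [expSum]
  refine Eq.trans (Finset.sum_congr rfl fun v _ => ?_) h.symm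
  simp only [← AddChar.map_add_eq_mul]
  congr 1
  simp [evalFormZ]
  ring

open Classical in
theorem totient_mul_sum_wn (a b : Fin 4 → ℤ) :
    (Nat.totient n : ℂ) * ∑ v ∈ Fintype.piFinset fun i => Icc (a i) (b i), (wn n v : ℂ) =
      (n : ℂ)⁻¹ * ∑ k : ZMod n, ∑ xy : ZMod n × ZMod n with IsCoprime xy.1 xy.2,
        expSumProd a b k xy := by
  have h1 : ∀ v, (Nat.totient n : ℂ) * wn n v =
      ∑ xy : ZMod n × ZMod n with IsCoprime xy.1 xy.2,
        (n : ℂ)⁻¹ * ∑ k : ZMod n, ZMod.stdAddChar (k * evalFormZ n v xy) := by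
    intro v
    rw [← Nat.cast_mul, totient_mul_wn, ← Finset.filter_filter, Finset.card_filter, Nat.cast_sum]
    refine Finset.sum_congr rfl fun xy _ => ?_
    rw [← indicator_eq_sum_stdAddChar]
    split_ifs <;> simp
  rw [Finset.mul_sum]
  simp only [h1, ← sum_stdAddChar_evalFormZ, ← Finset.mul_sum]
  congr 1
  rw [Finset.sum_comm, Finset.sum_comm (s := univ)]
  exact Finset.sum_congr rfl fun xy _ => Finset.sum_comm

theorem expSum_zero (a b : ℤ) : expSum a b (0 : ZMod n) = #(Icc a b) := by
  simp [expSum]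

theorem norm_expSum_le_card (a b : ℤ) (z : ZMod n) : ‖expSum a b z‖ ≤ #(Icc a b) := by
  refine (norm_sum_le _ _).trans ?_
  simp [AddChar.norm_apply]

theorem four_mul_le_norm_stdAddChar_sub_one (z : ZMod n) :
    4 * (z.valMinAbs.natAbs : ℝ) / n ≤ ‖(ZMod.stdAddChar z : ℂ) - 1‖ := by
  have hn : (0 : ℝ) < n := Nat.cast_pos.2 (NeZero.pos n)
  have hz : (z.valMinAbs.natAbs : ℝ) = |(z.valMinAbs : ℝ)| := by
    rw [Nat.cast_natAbs, Int.cast_abs]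
  have h2 : 2 * (z.valMinAbs.natAbs : ℝ) ≤ n := by
    have := ZMod.natAbs_valMinAbs_le z
    exact_mod_cast (by omega : 2 * z.valMinAbs.natAbs ≤ n)
  conv_rhs => rw [← ZMod.coe_valMinAbs z, ZMod.stdAddChar_coe]
  have : 2 * (Real.pi : ℂ) * Complex.I * (z.valMinAbs : ℂ) / n =
      Complex.I * ((2 * Real.pi * z.valMinAbs / n : ℝ) : ℂ) := by
    push_cast; ring
  rw [this, Complex.norm_exp_I_mul_ofReal_sub_one, norm_mul, Real.norm_ofNat, Real.norm_eq_abs]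
  have habs : |2 * Real.pi * (z.valMinAbs : ℝ) / n / 2| = Real.pi * z.valMinAbs.natAbs / n := by
    rw [hz, show 2 * Real.pi * (z.valMinAbs : ℝ) / n / 2 = Real.pi / n * z.valMinAbs by ring,
      abs_mul, abs_of_pos (by positivity)]
    ring
  have h := Real.mul_abs_le_abs_sin (x := 2 * Real.pi * z.valMinAbs / n / 2) (by
    rw [habs, div_le_div_iff₀ hn two_pos]
    nlinarith [Real.pi_pos])
  rw [habs] at h
  have e : 4 * (z.valMinAbs.natAbs : ℝ) / n =
      2 * (2 / Real.pi * (Real.pi * z.valMinAbs.natAbs / n)) := by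
    field_simp [Real.pi_ne_zero]; ring
  rw [e]
  linarith

theorem norm_expSum_mul_le (a b : ℤ) (z : ZMod n) :
    ‖expSum a b z‖ * ‖(ZMod.stdAddChar z : ℂ) - 1‖ ≤ 2 := by
  rcases lt_or_ge b a with hab | hab
  · simp [expSum, Finset.Icc_eq_empty_of_lt hab]
  have h : expSum a b z * ((ZMod.stdAddChar z : ℂ) - 1) =
      ZMod.stdAddChar (((b + 1 : ℤ) : ZMod n) * z) - ZMod.stdAddChar ((a : ZMod n) * z) := by
    induction b, hab using Int.leInduction with
    | base =>
      simp [expSum, add_mul, AddChar.map_add_eq_mul]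
      ring
    | succ b hb ih =>
      have : Icc a (b + 1) = insert (b + 1) (Icc a b) := by
        ext x; simp only [mem_Icc, mem_insert]; omega
      rw [expSum, this, Finset.sum_insert (by simp), add_mul, ← expSum, ih]
      push_cast
      simp only [add_mul, AddChar.map_add_eq_mul, one_mul]
      ring
  rw [← norm_mul, h]
  refine (norm_sub_le _ _).trans ?_
  simp only [AddChar.norm_apply]
  norm_num

theorem norm_expSum_le {a b : ℤ} (hab : (#(Icc a b) : ℝ) ≤ 2 * n) (z : ZMod n) :
    ‖expSum a b z‖ ≤ 2 * n * (absRes z)⁻¹ := by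
  have hn : (0 : ℝ) < n := Nat.cast_pos.2 (NeZero.pos n)
  by_cases hz : z = 0
  · subst hz
    simpa [absRes] using (norm_expSum_le_card a b 0).trans hab
  · have hp := absRes_pos z
    have h1 := four_mul_le_norm_stdAddChar_sub_one z
    have h2 := norm_expSum_mul_le a b z
    rw [← absRes_of_ne_zero hz] at h1
    have h3 := (mul_le_mul_of_nonneg_left h1 (norm_nonneg (expSum a b z))).trans h2
    rw [mul_div_assoc', div_le_iff₀ hn] at h3
    rw [← div_eq_mul_inv, le_div_iff₀ hp]
    linarith

end Fourier

section LocalFibre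

variable {n : ℕ}

open Classical in
theorem local_fibre_sum_le {p : ℕ} [hp : Fact p.Prime] (s t u : ZMod p) :
    (∑ v : ZMod p × ZMod p × ZMod p,
      if ¬ (v.2.1 = 0 ∧ v.2.2 = 0) ∧ v.1 * v.2.1 ^ 3 = s ∧ v.1 * (v.2.1 ^ 2 * v.2.2) = t ∧
        v.1 * v.2.2 ^ 3 = u then (if v.1 = 0 then (p : ℝ)⁻¹ else 1) else 0) ≤ 2 * (p - 1) := by
  have hp1 : (1 : ℝ) < p := by exact_mod_cast hp.out.one_lt
  by_cases hsu : s = 0 ∧ u = 0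
  · obtain ⟨rfl, rfl⟩ := hsu
    have hle : ∀ v : ZMod p × ZMod p × ZMod p,
        (if ¬ (v.2.1 = 0 ∧ v.2.2 = 0) ∧ v.1 * v.2.1 ^ 3 = 0 ∧ v.1 * (v.2.1 ^ 2 * v.2.2) = t ∧
          v.1 * v.2.2 ^ 3 = 0 then (if v.1 = 0 then (p : ℝ)⁻¹ else 1) else 0) ≤
        if v.1 = 0 then (p : ℝ)⁻¹ * (1 - if v.2 = 0 then 1 else 0) else 0 := by
      rintro ⟨k, x, y⟩
      by_cases hk : k = 0
      · by_cases hxy : x = 0 ∧ y = 0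
        · simp [hk, hxy]
        · simp only [hk, Prod.ext_iff, Prod.fst_zero, Prod.snd_zero, hxy, if_true, if_false]
          split_ifs <;> simp
      · have : ¬ (¬ (x = 0 ∧ y = 0) ∧ k * x ^ 3 = 0 ∧ k * (x ^ 2 * y) = t ∧ k * y ^ 3 = 0) := by
          rintro ⟨hxy, hx, -, hy⟩
          simp only [mul_eq_zero, hk, false_or, pow_eq_zero_iff (three_ne_zero)] at hx hy
          exact hxy ⟨hx, hy⟩
        dsimp only
        rw [if_neg this, if_neg hk]
    refine (Finset.sum_le_sum fun v _ => hle v).trans ?_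
    rw [Fintype.sum_prod_type]
    simp only [Finset.sum_ite_irrel, Finset.sum_const_zero, Finset.sum_ite_eq', Finset.mem_univ,
      if_true, ← Finset.mul_sum, Finset.sum_sub_distrib, Finset.sum_const, Finset.card_univ,
      Fintype.card_prod, ZMod.card]
    rw [inv_mul_le_iff₀ (by linarith)]
    simp
    nlinarith
  · rw [← Finset.sum_filter]
    set A : Finset (ZMod p × ZMod p × ZMod p) := univ.filter fun v =>
      ¬ (v.2.1 = 0 ∧ v.2.2 = 0) ∧ v.1 * v.2.1 ^ 3 = s ∧ v.1 * (v.2.1 ^ 2 * v.2.2) = t ∧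
        v.1 * v.2.2 ^ 3 = u with hA
    have hcard : #A ≤ #((univ : Finset (ZMod p)).erase 0) := by
      by_cases hs : s = 0
      · have hu : u ≠ 0 := fun hu => hsu ⟨hs, hu⟩
        refine Finset.card_le_card_of_injOn (fun v => v.2.2) ?_ ?_
        · rintro ⟨k, x, y⟩ hv
          simp only [hA, coe_filter, Set.mem_ofPred_eq] at hv
          simp only [coe_erase, coe_univ, Set.mem_sdiff, Set.mem_univ, true_and,
            Set.mem_singleton_iff]
          rintro rfl
          exact hu (by rw [← hv.2.2.2.2]; ring)
        · rintro ⟨k, x, y⟩ hv ⟨k', x', y'⟩ hv' hyy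
          simp only [hA, coe_filter, Set.mem_ofPred_eq, mem_univ, true_and] at hv hv'
          obtain rfl : y = y' := hyy
          have hk : k ≠ 0 := fun h => hu (by rw [← hv.2.2.2, h, zero_mul])
          have hy : y ≠ 0 := fun h => hu (by rw [← hv.2.2.2, h]; ring)
          have hkk : k = k' :=
            mul_right_cancel₀ (pow_ne_zero 3 hy) (hv.2.2.2.trans hv'.2.2.2.symm)
          subst hkk
          have hx := hv.2.1
          have hx' := hv'.2.1
          simp only [hs, mul_eq_zero, hk, false_or, pow_eq_zero_iff (three_ne_zero)] at hx hx'
          rw [hx, hx']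
      · refine Finset.card_le_card_of_injOn (fun v => v.2.1) ?_ ?_
        · rintro ⟨k, x, y⟩ hv
          simp only [hA, coe_filter, Set.mem_ofPred_eq] at hv
          simp only [coe_erase, coe_univ, Set.mem_sdiff, Set.mem_univ, true_and,
            Set.mem_singleton_iff]
          rintro rfl
          exact hs (by rw [← hv.2.2.1]; ring)
        · rintro ⟨k, x, y⟩ hv ⟨k', x', y'⟩ hv' hxx
          simp only [hA, coe_filter, Set.mem_ofPred_eq, mem_univ, true_and] at hv hv'
          obtain rfl : x = x' := hxx
          have hk : k ≠ 0 := fun h => hs (by rw [← hv.2.1, h, zero_mul])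
          have hx : x ≠ 0 := fun h => hs (by rw [← hv.2.1, h]; ring)
          have hkk : k = k' :=
            mul_right_cancel₀ (pow_ne_zero 3 hx) (hv.2.1.trans hv'.2.1.symm)
          subst hkk
          have := mul_left_cancel₀ (pow_ne_zero 2 hx)
            (mul_left_cancel₀ hk (hv.2.2.1.trans hv'.2.2.1.symm))
          rw [this]
    have hcard' : (#A : ℝ) ≤ p - 1 := by
      rw [Finset.card_erase_of_mem (mem_univ _), Finset.card_univ, ZMod.card] at hcard
      rw [← Nat.cast_one, ← Nat.cast_sub hp.out.one_le]
      exact_mod_cast hcard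
    calc _ ≤ ∑ v ∈ A, (1 : ℝ) := by
          refine Finset.sum_le_sum fun v _ => ?_
          split_ifs
          · exact inv_le_one_of_one_le₀ hp1.le
          · exact le_rfl
      _ = #A := by simp
      _ ≤ _ := by linarith

open Classical in
/-- The product of the primes `p ∣ n` modulo which `k` vanishes. -/
noncomputable def vanishingModulus (k : ZMod n) : ℕ :=
  ∏ p : n.primeFactors, if redMod p k = 0 then (p : ℕ) else 1

theorem vanishingModulus_pos (k : ZMod n) : 0 < vanishingModulus k := by
  refine Finset.prod_pos fun p _ => ?_
  split_ifs
  · exact (primeFactors_fact p).out.pos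
  · exact one_pos

theorem vanishingModulus_dvd (k : ZMod n) {m : ℕ}
    (h : ∀ p : n.primeFactors, redMod p k = 0 → (p : ℕ) ∣ m) : vanishingModulus k ∣ m := by
  classical
  rw [vanishingModulus, ← Finset.prod_filter,
    ← Finset.prod_image (f := fun q : ℕ => q) (g := fun p : n.primeFactors => (p : ℕ))
      (Subtype.val_injective.injOn)]
  refine Finset.prod_primes_dvd _ ?_ ?_
  · intro q hq
    obtain ⟨p, -, rfl⟩ := Finset.mem_image.1 hq
    exact (primeFactors_fact p).out.prime
  · intro q hq
    obtain ⟨p, hp, rfl⟩ := Finset.mem_image.1 hq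
    exact h p (Finset.mem_filter.1 hp).2

theorem vanishingModulus_dvd_self (k : ZMod n) : vanishingModulus k ∣ n :=
  vanishingModulus_dvd k fun p _ => Nat.dvd_of_mem_primeFactors p.2

theorem vanishingModulus_dvd_natAbs (k c : ZMod n) :
    vanishingModulus k ∣ (k * c).valMinAbs.natAbs := by
  refine vanishingModulus_dvd k fun p hp => ?_
  rw [← Int.natCast_dvd, ← ZMod.intCast_zmod_eq_zero_iff_dvd, ← redMod_intCast,
    ZMod.coe_valMinAbs, map_mul, hp, zero_mul]

open Classical in
theorem fibre_sum_le [NeZero n] (hn : Squarefree n) (s t u : ZMod n) :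
    (∑ v : ZMod n × ZMod n × ZMod n,
      if IsCoprime v.2.1 v.2.2 ∧ v.1 * v.2.1 ^ 3 = s ∧ v.1 * (v.2.1 ^ 2 * v.2.2) = t ∧
        v.1 * v.2.2 ^ 3 = u then (vanishingModulus v.1 : ℝ)⁻¹ else 0) ≤
      #n.divisors * Nat.totient n := by
  rw [card_divisors_of_squarefree hn, totient_eq_prod_of_squarefree hn, ← Finset.prod_mul_distrib]
  refine le_trans ?_ (Finset.prod_le_prod (fun p _ => ?_) fun p _ =>
    local_fibre_sum_le (redMod p s) (redMod p t) (redMod p u))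
  · rw [← sum_triple_eq_prod hn]
    refine Finset.sum_le_sum fun v _ => ?_
    split_ifs with h
    · obtain ⟨h0, rfl, rfl, rfl⟩ := h
      rw [vanishingModulus, Nat.cast_prod, ← Finset.prod_inv_distrib]
      refine (Finset.prod_congr rfl fun p _ => ?_).le
      refine Eq.trans ?_ (if_pos ⟨(isCoprime_iff_redMod hn _ _).1 h0 p, by simp, by simp,
        by simp⟩).symm
      dsimp only
      split_ifs <;> simp
    · refine Finset.prod_nonneg fun p _ => ?_
      split_ifs <;> positivity
  · refine Finset.sum_nonneg fun v _ => ?_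
    split_ifs <;> positivity

end LocalFibre

section Weights

variable {n : ℕ}

/-- The weight `gcd(|z|, n) / |z|`, with value `1` at `z = 0`. -/
noncomputable def gcdWeight (z : ZMod n) : ℝ :=
  if z = 0 then 1 else (z.valMinAbs.natAbs.gcd n : ℝ) / z.valMinAbs.natAbs

theorem gcdWeight_nonneg (z : ZMod n) : 0 ≤ gcdWeight z := by
  rw [gcdWeight]; split_ifs <;> positivity

theorem dvd_mul_inv_absRes_le {z : ZMod n} (hz : z ≠ 0) {g : ℕ} (hgn : g ∣ n)
    (hg : g ∣ z.valMinAbs.natAbs) : g * (absRes z)⁻¹ ≤ gcdWeight z := by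
  rw [absRes_of_ne_zero hz, gcdWeight, if_neg hz, ← div_eq_mul_inv]
  have : 0 < z.valMinAbs.natAbs := Int.natAbs_pos.2 ((ZMod.valMinAbs_eq_zero z).not.2 hz)
  gcongr
  exact Nat.le_of_dvd (Nat.gcd_pos_of_pos_left _ this) (Nat.dvd_gcd hg hgn)

theorem inv_absRes_le_gcdWeight (z : ZMod n) : (absRes z)⁻¹ ≤ gcdWeight z := by
  by_cases hz : z = 0
  · simp [hz, absRes, gcdWeight]
  · simpa using dvd_mul_inv_absRes_le hz (one_dvd n) (one_dvd _)

theorem mul_inv_absRes_le_one {z : ZMod n} (hz : z ≠ 0) {g : ℕ}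
    (hg : g ∣ z.valMinAbs.natAbs) : g * (absRes z)⁻¹ ≤ 1 := by
  have : 0 < z.valMinAbs.natAbs := Int.natAbs_pos.2 ((ZMod.valMinAbs_eq_zero z).not.2 hz)
  rw [← div_eq_mul_inv, div_le_one (absRes_pos z), absRes_of_ne_zero hz]
  exact_mod_cast Nat.le_of_dvd this hg

theorem inv_absRes_le_one (z : ZMod n) : (absRes z)⁻¹ ≤ 1 :=
  inv_le_one_of_one_le₀ (le_max_left _ _)

theorem inv_absRes_nonneg (z : ZMod n) : 0 ≤ (absRes z)⁻¹ := (inv_pos.2 (absRes_pos z)).le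

theorem prod_inv_absRes_le {k x y : ZMod n} (hk : k ≠ 0) (hxy : IsCoprime x y) :
    (absRes (k * x ^ 3))⁻¹ * (absRes (k * (x ^ 2 * y)))⁻¹ * (absRes (k * (x * y ^ 2)))⁻¹ *
        (absRes (k * y ^ 3))⁻¹ ≤
      (vanishingModulus k : ℝ)⁻¹ * (gcdWeight (k * x ^ 3) * gcdWeight (k * (x ^ 2 * y)) *
        gcdWeight (k * y ^ 3)) := by
  have hg : (0 : ℝ) < vanishingModulus k := Nat.cast_pos.2 (vanishingModulus_pos k)
  rw [le_inv_mul_iff₀ hg]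
  have hd := fun c => vanishingModulus_dvd_natAbs k c
  have hdn := vanishingModulus_dvd_self k
  set g : ℝ := (vanishingModulus k : ℝ)
  have hF := inv_absRes_le_gcdWeight (n := n)
  have h0 := inv_absRes_nonneg (n := n)
  have h1 := inv_absRes_le_one (n := n)
  have hG := gcdWeight_nonneg (n := n)
  by_cases hw : k * (x * y ^ 2) = 0
  · by_cases hs : k * x ^ 3 = 0
    · have hu : k * y ^ 3 ≠ 0 := by
        intro hu
        obtain ⟨a, b, hab⟩ := hxy.pow (m := 3) (n := 3)
        apply hk
        linear_combination -k * hab + a * hs + b * hu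
      have h := dvd_mul_inv_absRes_le hu hdn (hd _)
      calc _ = (absRes (k * x ^ 3))⁻¹ * (absRes (k * (x ^ 2 * y)))⁻¹ *
            (g * (absRes (k * y ^ 3))⁻¹) * (absRes (k * (x * y ^ 2)))⁻¹ := by ring
        _ ≤ gcdWeight (k * x ^ 3) * gcdWeight (k * (x ^ 2 * y)) * gcdWeight (k * y ^ 3) * 1 := by
          have := h0 (k * x ^ 3)
          have := h0 (k * (x ^ 2 * y))
          have := hG (k * x ^ 3)
          have := hG (k * (x ^ 2 * y))
          have := hG (k * y ^ 3)
          have := h0 (k * y ^ 3)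
          gcongr <;> first | exact hF _ | exact h1 _ | exact h0 _
        _ = _ := mul_one _
    · have h := dvd_mul_inv_absRes_le hs hdn (hd _)
      calc _ = (g * (absRes (k * x ^ 3))⁻¹) * (absRes (k * (x ^ 2 * y)))⁻¹ *
            (absRes (k * y ^ 3))⁻¹ * (absRes (k * (x * y ^ 2)))⁻¹ := by ring
        _ ≤ gcdWeight (k * x ^ 3) * gcdWeight (k * (x ^ 2 * y)) * gcdWeight (k * y ^ 3) * 1 := by
          have := h0 (k * x ^ 3)
          have := h0 (k * (x ^ 2 * y))
          have := hG (k * x ^ 3)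
          have := hG (k * (x ^ 2 * y))
          have := hG (k * y ^ 3)
          have := h0 (k * y ^ 3)
          gcongr <;> first | exact hF _ | exact h1 _ | exact h0 _
        _ = _ := mul_one _
  · have h := mul_inv_absRes_le_one hw (hd _)
    calc _ = (absRes (k * x ^ 3))⁻¹ * (absRes (k * (x ^ 2 * y)))⁻¹ *
          (absRes (k * y ^ 3))⁻¹ * (g * (absRes (k * (x * y ^ 2)))⁻¹) := by ring
      _ ≤ gcdWeight (k * x ^ 3) * gcdWeight (k * (x ^ 2 * y)) * gcdWeight (k * y ^ 3) * 1 := by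
        have := h0 (k * x ^ 3)
        have := h0 (k * (x ^ 2 * y))
        have := hG (k * x ^ 3)
        have := hG (k * (x ^ 2 * y))
        have := hG (k * y ^ 3)
        have := h0 (k * y ^ 3)
        have := h0 (k * (x * y ^ 2))
        gcongr <;> exact hF _
      _ = _ := mul_one _

theorem sum_dvd_div_le_harmonic {d : ℕ} (hd : 0 < d) (N : ℕ) :
    ∑ m ∈ Icc 1 N with d ∣ m, (d : ℝ) / m ≤ harmonic N := by
  rw [harmonic_eq_sum_Icc, Rat.cast_sum]
  have h : ∀ m ∈ (Icc 1 N).filter (d ∣ ·), (d : ℝ) / m =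
      (fun i : ℕ => (((i : ℚ)⁻¹ : ℚ) : ℝ)) (m / d) := by
    intro m hm
    obtain ⟨c, rfl⟩ := (Finset.mem_filter.1 hm).2
    have : (d : ℝ) ≠ 0 := by positivity
    simp only [Nat.mul_div_cancel_left c hd]
    push_cast
    rw [div_mul_eq_div_div, div_self this, one_div]
  rw [Finset.sum_congr rfl h, ← Finset.sum_image (g := fun m => m / d)
    (f := fun i : ℕ => (((i : ℚ)⁻¹ : ℚ) : ℝ))]
  · refine Finset.sum_le_sum_of_subset_of_nonneg ?_ fun i _ _ => by positivity
    intro i hi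
    obtain ⟨m, hm, rfl⟩ := Finset.mem_image.1 hi
    obtain ⟨hm, c, rfl⟩ := Finset.mem_filter.1 hm
    rw [Finset.mem_Icc] at hm
    rw [Nat.mul_div_cancel_left c hd, Finset.mem_Icc]
    constructor
    · rcases Nat.eq_zero_or_pos c with rfl | h
      · omega
      · exact h
    · exact (Nat.le_mul_of_pos_left c hd).trans hm.2
  · intro a ha b hb hab
    exact (Nat.div_left_inj (Finset.mem_filter.1 ha).2 (Finset.mem_filter.1 hb).2).1 hab

theorem sum_gcd_div_le (hn : n ≠ 0) :
    ∑ m ∈ Icc 1 n, (m.gcd n : ℝ) / m ≤ #n.divisors * harmonic n := by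
  calc ∑ m ∈ Icc 1 n, (m.gcd n : ℝ) / m
      ≤ ∑ m ∈ Icc 1 n, ∑ d ∈ n.divisors, if d ∣ m then (d : ℝ) / m else 0 := by
        refine Finset.sum_le_sum fun m _ => ?_
        refine le_trans ?_ (Finset.single_le_sum (a := m.gcd n) (fun d _ => ?_)
          (Nat.mem_divisors.2 ⟨Nat.gcd_dvd_right m n, hn⟩))
        · rw [if_pos (Nat.gcd_dvd_left m n)]
        · split_ifs <;> positivity
    _ = ∑ d ∈ n.divisors, ∑ m ∈ Icc 1 n with d ∣ m, (d : ℝ) / m := by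
        rw [Finset.sum_comm]
        simp only [Finset.sum_filter]
    _ ≤ ∑ d ∈ n.divisors, (harmonic n : ℝ) :=
        Finset.sum_le_sum fun d hd => sum_dvd_div_le_harmonic (Nat.pos_of_mem_divisors hd) n
    _ = _ := by rw [Finset.sum_const, nsmul_eq_mul]

theorem sum_gcdWeight_le [NeZero n] :
    ∑ z : ZMod n, gcdWeight z ≤ 1 + 2 * (#n.divisors * harmonic n) := by
  classical
  rw [← Finset.add_sum_erase _ _ (mem_univ (0 : ZMod n))]
  refine add_le_add (by simp [gcdWeight]) ?_
  have h : ∀ z ∈ (univ : Finset (ZMod n)).erase 0, gcdWeight z =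
      (fun a : ℕ × Bool => (a.1.gcd n : ℝ) / a.1)
        (z.valMinAbs.natAbs, decide (0 ≤ z.valMinAbs)) := by
    intro z hz
    simp only [gcdWeight, if_neg (Finset.ne_of_mem_erase hz)]
  rw [Finset.sum_congr rfl h, ← Finset.sum_image (f := fun a : ℕ × Bool => (a.1.gcd n : ℝ) / a.1)
    (g := fun z : ZMod n => (z.valMinAbs.natAbs, decide (0 ≤ z.valMinAbs)))]
  · refine (Finset.sum_le_sum_of_subset_of_nonneg
      (t := Icc 1 n ×ˢ (univ : Finset Bool)) ?_ fun a _ _ => by positivity).trans ?_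
    · intro a ha
      obtain ⟨z, hz, rfl⟩ := Finset.mem_image.1 ha
      have h1 := (ZMod.valMinAbs_eq_zero z).not.2 (Finset.ne_of_mem_erase hz)
      have h2 := ZMod.natAbs_valMinAbs_le z
      simp only [Finset.mem_product, Finset.mem_Icc, Finset.mem_univ, and_true]
      omega
    · rw [Finset.sum_product]
      simp only [Finset.sum_const, Finset.card_univ, Fintype.card_bool, nsmul_eq_mul,
        ← Finset.mul_sum]
      exact mul_le_mul_of_nonneg_left (sum_gcd_div_le (NeZero.ne n)) (by norm_num)
  · intro z _ w _ hzw
    simp only [Prod.mk.injEq, decide_eq_decide] at hzw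
    exact ZMod.injective_valMinAbs (by omega)

end Weights

section ErrorTerm

variable {n : ℕ} [NeZero n]

theorem norm_expSumProd_le {a b : Fin 4 → ℤ} (hab : ∀ i, (#(Icc (a i) (b i)) : ℝ) ≤ 2 * n)
    {k : ZMod n} (hk : k ≠ 0) {xy : ZMod n × ZMod n} (hxy : IsCoprime xy.1 xy.2) :
    ‖expSumProd a b k xy‖ ≤ (2 * n) ^ 4 * ((vanishingModulus k : ℝ)⁻¹ *
      (gcdWeight (k * xy.1 ^ 3) * gcdWeight (k * (xy.1 ^ 2 * xy.2)) *
        gcdWeight (k * xy.2 ^ 3))) := by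
  rw [expSumProd, norm_mul, norm_mul, norm_mul]
  calc _ ≤ (2 * n * (absRes (k * xy.1 ^ 3))⁻¹) * (2 * n * (absRes (k * (xy.1 ^ 2 * xy.2)))⁻¹) *
        (2 * n * (absRes (k * (xy.1 * xy.2 ^ 2)))⁻¹) * (2 * n * (absRes (k * xy.2 ^ 3))⁻¹) := by
        have := fun z : ZMod n => inv_absRes_nonneg z
        have h0 := this (k * xy.1 ^ 3)
        have h1 := this (k * (xy.1 ^ 2 * xy.2))
        have h2 := this (k * (xy.1 * xy.2 ^ 2))
        gcongr <;> exact norm_expSum_le (hab _) _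
    _ = (2 * n) ^ 4 * ((absRes (k * xy.1 ^ 3))⁻¹ * (absRes (k * (xy.1 ^ 2 * xy.2)))⁻¹ *
        (absRes (k * (xy.1 * xy.2 ^ 2)))⁻¹ * (absRes (k * xy.2 ^ 3))⁻¹) := by ring
    _ ≤ _ := mul_le_mul_of_nonneg_left (prod_inv_absRes_le hk hxy) (by positivity)

open Classical in
theorem sum_gcdWeight_triple_le (hn : Squarefree n) :
    ∑ k : ZMod n, ∑ xy : ZMod n × ZMod n with IsCoprime xy.1 xy.2,
      (vanishingModulus k : ℝ)⁻¹ * (gcdWeight (k * xy.1 ^ 3) *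
        gcdWeight (k * (xy.1 ^ 2 * xy.2)) * gcdWeight (k * xy.2 ^ 3)) ≤
      #n.divisors * Nat.totient n * (∑ z : ZMod n, gcdWeight z) ^ 3 := by
  have h1 : ∀ v : ZMod n × ZMod n × ZMod n,
      (if IsCoprime v.2.1 v.2.2 then (vanishingModulus v.1 : ℝ)⁻¹ * (gcdWeight (v.1 * v.2.1 ^ 3) *
        gcdWeight (v.1 * (v.2.1 ^ 2 * v.2.2)) * gcdWeight (v.1 * v.2.2 ^ 3)) else 0) =
      ∑ s : ZMod n, ∑ t : ZMod n, ∑ u : ZMod n, gcdWeight s * gcdWeight t * gcdWeight u *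
        if IsCoprime v.2.1 v.2.2 ∧ v.1 * v.2.1 ^ 3 = s ∧ v.1 * (v.2.1 ^ 2 * v.2.2) = t ∧
          v.1 * v.2.2 ^ 3 = u then (vanishingModulus v.1 : ℝ)⁻¹ else 0 := by
    intro v
    by_cases h : IsCoprime v.2.1 v.2.2
    · simp only [h, true_and, ite_and, mul_ite, mul_zero, Finset.sum_ite_irrel,
        Finset.sum_const_zero, Finset.sum_ite_eq, Finset.mem_univ, if_true]
      ring
    · simp [h]
  have h2 : ∑ k : ZMod n, ∑ xy : ZMod n × ZMod n with IsCoprime xy.1 xy.2,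
      (vanishingModulus k : ℝ)⁻¹ * (gcdWeight (k * xy.1 ^ 3) *
        gcdWeight (k * (xy.1 ^ 2 * xy.2)) * gcdWeight (k * xy.2 ^ 3)) =
      ∑ v : ZMod n × ZMod n × ZMod n,
      (if IsCoprime v.2.1 v.2.2 then (vanishingModulus v.1 : ℝ)⁻¹ * (gcdWeight (v.1 * v.2.1 ^ 3) *
        gcdWeight (v.1 * (v.2.1 ^ 2 * v.2.2)) * gcdWeight (v.1 * v.2.2 ^ 3)) else 0) := by
    rw [Fintype.sum_prod_type]
    exact Finset.sum_congr rfl fun k _ => Finset.sum_filter _ _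
  rw [h2, Finset.sum_congr rfl fun v _ => h1 v, Finset.sum_comm]
  have h3 : ∀ s t u : ZMod n, gcdWeight s * gcdWeight t * gcdWeight u *
      ∑ v : ZMod n × ZMod n × ZMod n,
        (if IsCoprime v.2.1 v.2.2 ∧ v.1 * v.2.1 ^ 3 = s ∧ v.1 * (v.2.1 ^ 2 * v.2.2) = t ∧
          v.1 * v.2.2 ^ 3 = u then (vanishingModulus v.1 : ℝ)⁻¹ else 0) ≤
      gcdWeight s * gcdWeight t * gcdWeight u * (#n.divisors * Nat.totient n) := fun s t u =>
    mul_le_mul_of_nonneg_left (fibre_sum_le hn s t u)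
      (mul_nonneg (mul_nonneg (gcdWeight_nonneg s) (gcdWeight_nonneg t)) (gcdWeight_nonneg u))
  calc _ = ∑ s : ZMod n, ∑ t : ZMod n, ∑ u : ZMod n, gcdWeight s * gcdWeight t * gcdWeight u *
      ∑ v : ZMod n × ZMod n × ZMod n,
        (if IsCoprime v.2.1 v.2.2 ∧ v.1 * v.2.1 ^ 3 = s ∧ v.1 * (v.2.1 ^ 2 * v.2.2) = t ∧
          v.1 * v.2.2 ^ 3 = u then (vanishingModulus v.1 : ℝ)⁻¹ else 0) := by
        refine Finset.sum_congr rfl fun s _ => ?_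
        rw [Finset.sum_comm]
        refine Finset.sum_congr rfl fun t _ => ?_
        rw [Finset.sum_comm]
        exact Finset.sum_congr rfl fun u _ => (Finset.mul_sum _ _ _).symm
    _ ≤ ∑ s : ZMod n, ∑ t : ZMod n, ∑ u : ZMod n, gcdWeight s * gcdWeight t * gcdWeight u *
        (#n.divisors * Nat.totient n) :=
      Finset.sum_le_sum fun s _ => Finset.sum_le_sum fun t _ => Finset.sum_le_sum fun u _ =>
        h3 s t u
    _ = _ := by
      simp only [← Finset.sum_mul, ← Finset.mul_sum]
      ring

open Classical in
theorem norm_sum_expSumProd_le (hn : Squarefree n) {a b : Fin 4 → ℤ}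
    (hab : ∀ i, (#(Icc (a i) (b i)) : ℝ) ≤ 2 * n) :
    ‖∑ k ∈ (univ : Finset (ZMod n)).erase 0,
      ∑ xy : ZMod n × ZMod n with IsCoprime xy.1 xy.2, expSumProd a b k xy‖ ≤
    (2 * n) ^ 4 * (#n.divisors * Nat.totient n *
      (1 + 2 * (#n.divisors * harmonic n)) ^ 3) := by
  calc _ ≤ ∑ k ∈ (univ : Finset (ZMod n)).erase 0,
        ∑ xy : ZMod n × ZMod n with IsCoprime xy.1 xy.2, (2 * n : ℝ) ^ 4 *
          ((vanishingModulus k : ℝ)⁻¹ *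
          (gcdWeight (k * xy.1 ^ 3) * gcdWeight (k * (xy.1 ^ 2 * xy.2)) *
            gcdWeight (k * xy.2 ^ 3))) :=
        norm_sum_le_of_le _ fun k hk => norm_sum_le_of_le _ fun xy hxy =>
          norm_expSumProd_le hab (Finset.ne_of_mem_erase hk) (Finset.mem_filter.1 hxy).2
    _ ≤ ∑ k : ZMod n,
        ∑ xy : ZMod n × ZMod n with IsCoprime xy.1 xy.2, (2 * n : ℝ) ^ 4 *
          ((vanishingModulus k : ℝ)⁻¹ *
          (gcdWeight (k * xy.1 ^ 3) * gcdWeight (k * (xy.1 ^ 2 * xy.2)) *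
            gcdWeight (k * xy.2 ^ 3))) := by
        refine Finset.sum_le_sum_of_subset_of_nonneg (Finset.erase_subset _ _) fun k _ _ =>
          Finset.sum_nonneg fun xy _ => ?_
        have := gcdWeight_nonneg (k * xy.1 ^ 3)
        have := gcdWeight_nonneg (k * (xy.1 ^ 2 * xy.2))
        have := gcdWeight_nonneg (k * xy.2 ^ 3)
        positivity
    _ ≤ (2 * n : ℝ) ^ 4 * (#n.divisors * Nat.totient n *
        (∑ z : ZMod n, gcdWeight z) ^ 3) := by
        have h := mul_le_mul_of_nonneg_left (sum_gcdWeight_triple_le hn)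
          (by positivity : (0 : ℝ) ≤ (2 * n) ^ 4)
        simpa only [Finset.mul_sum] using h
    _ ≤ _ := by
        have := Finset.sum_nonneg fun z (_ : z ∈ (univ : Finset (ZMod n))) => gcdWeight_nonneg z
        gcongr
        exact sum_gcdWeight_le

/-- The number of roots in an integral box is the expected one up to an explicit error. -/
theorem abs_sum_wn_sub_le (hn : Squarefree n) {a b : Fin 4 → ℤ}
    (hab : ∀ i, (#(Icc (a i) (b i)) : ℝ) ≤ 2 * n) :
    |∑ v ∈ Fintype.piFinset fun i => Icc (a i) (b i), (wn n v : ℝ) -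
        (∑ d ∈ n.divisors, (d : ℝ)) / n * ∏ i, (#(Icc (a i) (b i)) : ℝ)| ≤
      16 * n ^ 3 * (#n.divisors * (1 + 2 * (#n.divisors * harmonic n)) ^ 3) := by
  classical
  have hn0 : (0 : ℝ) < n := Nat.cast_pos.2 (NeZero.pos n)
  have hφ : (0 : ℝ) < Nat.totient n := Nat.cast_pos.2 (Nat.totient_pos.2 (NeZero.pos n))
  have h := totient_mul_sum_wn (n := n) a b
  rw [← Finset.add_sum_erase _ _ (mem_univ (0 : ZMod n))] at h
  have hmain : ∑ xy : ZMod n × ZMod n with IsCoprime xy.1 xy.2,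
      expSumProd a b (0 : ZMod n) xy =
      (((Nat.totient n * ∑ d ∈ n.divisors, (d : ℝ)) * ∏ i, (#(Icc (a i) (b i)) : ℝ) : ℝ) : ℂ) := by
    rw [← card_isCoprime hn]
    simp only [expSumProd, zero_mul, expSum_zero, Finset.sum_const, nsmul_eq_mul,
      Fin.prod_univ_four]
    push_cast
    ring
  set E : ℂ := ∑ k ∈ (univ : Finset (ZMod n)).erase 0,
    ∑ xy : ZMod n × ZMod n with IsCoprime xy.1 xy.2, expSumProd a b k xy with hE
  have hEle : ‖E‖ ≤ _ := norm_sum_expSumProd_le hn hab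
  set W : ℝ := ∑ v ∈ Fintype.piFinset fun i => Icc (a i) (b i), (wn n v : ℝ) with hW
  set M : ℝ := (∑ d ∈ n.divisors, (d : ℝ)) / n * ∏ i, (#(Icc (a i) (b i)) : ℝ) with hM
  have hdiff : E = ((n * Nat.totient n * (W - M) : ℝ) : ℂ) := by
    have hWc : (W : ℂ) = ∑ v ∈ Fintype.piFinset fun i => Icc (a i) (b i), (wn n v : ℂ) := by
      rw [hW]; push_cast; rfl
    have hnc : (n : ℂ) ≠ 0 := Nat.cast_ne_zero.2 (NeZero.ne n)
    rw [hmain, ← hWc, eq_inv_mul_iff_mul_eq₀ hnc] at h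
    have hMn : (Nat.totient n * ∑ d ∈ n.divisors, (d : ℝ)) * ∏ i, (#(Icc (a i) (b i)) : ℝ) =
        n * Nat.totient n * M := by
      have aux : ∀ {c s x P : ℝ}, c ≠ 0 → x * s * P = c * x * (s / c * P) := by
        intro c s x P hc; field_simp
      exact aux hn0.ne'
    rw [hMn] at h
    push_cast at h ⊢
    linear_combination -h
  rw [hdiff, Complex.norm_real, Real.norm_eq_abs, abs_mul, abs_of_pos (mul_pos hn0 hφ)] at hEle
  refine le_of_mul_le_mul_left ?_ (mul_pos hn0 hφ)
  calc _ ≤ _ := hEle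
    _ = _ := by ring

end ErrorTerm

section Bounds

theorem exists_card_divisors_le_rpow (δ : ℝ) (hδ : 0 < δ) :
    ∃ C : ℝ, ∀ n : ℕ, Squarefree n → (#n.divisors : ℝ) ≤ C * (n : ℝ) ^ δ := by
  obtain ⟨M, hM⟩ := exists_nat_ge ((2 : ℝ) ^ δ⁻¹)
  refine ⟨2 ^ M, fun n hn => ?_⟩
  have hC : ∏ p : n.primeFactors, (if (p : ℕ) < M then (2 : ℝ) else 1) ≤ 2 ^ M := by
    rw [Finset.prod_coe_sort n.primeFactors (fun p => if p < M then (2 : ℝ) else 1),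
      ← Finset.prod_filter, Finset.prod_const]
    refine pow_le_pow_right₀ one_le_two ?_
    calc #(n.primeFactors.filter (· < M)) ≤ #(Finset.range M) :=
          Finset.card_le_card fun p hp => Finset.mem_range.2 (Finset.mem_filter.1 hp).2
      _ = M := Finset.card_range M
  calc (#n.divisors : ℝ) = ∏ _p : n.primeFactors, (2 : ℝ) := card_divisors_of_squarefree hn
    _ ≤ ∏ p : n.primeFactors, ((if (p : ℕ) < M then (2 : ℝ) else 1) * (p : ℝ) ^ δ) := by
        refine Finset.prod_le_prod (fun _ _ => two_pos.le) fun p _ => ?_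
        have hp : (1 : ℝ) ≤ p := by exact_mod_cast (primeFactors_fact p).out.one_le
        split_ifs with h
        · have := Real.one_le_rpow hp hδ.le
          linarith
        · have h' : (2 : ℝ) ^ δ⁻¹ ≤ p := hM.trans (by exact_mod_cast not_lt.1 h)
          have := Real.rpow_le_rpow (by positivity) h' hδ.le
          rwa [Real.rpow_inv_rpow two_pos.le hδ.ne', ← one_mul ((p : ℝ) ^ δ)] at this
    _ = (∏ p : n.primeFactors, (if (p : ℕ) < M then (2 : ℝ) else 1)) * (n : ℝ) ^ δ := by
        rw [Finset.prod_mul_distrib, Real.finsetProd_rpow _ _ fun p _ => Nat.cast_nonneg _,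
          ← cast_eq_prod_of_squarefree hn]
    _ ≤ _ := mul_le_mul_of_nonneg_right hC (by positivity)

theorem one_add_log_le_rpow {δ : ℝ} (hδ : 0 < δ) {x : ℝ} (hx : 1 ≤ x) :
    1 + Real.log x ≤ (1 + δ⁻¹) * x ^ δ := by
  have h1 := Real.one_le_rpow hx hδ.le
  have h2 := Real.log_le_rpow_div (zero_le_one.trans hx) hδ
  rw [div_eq_mul_inv] at h2
  linarith

theorem abs_prod_four_sub_le {N L : Fin 4 → ℝ} {B : ℝ} (hN : ∀ i, |N i| ≤ B) (hL : ∀ i, |L i| ≤ B)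
    (hNL : ∀ i, |N i - L i| ≤ 1) : |∏ i, N i - ∏ i, L i| ≤ 4 * B ^ 3 := by
  have hB : 0 ≤ B := (abs_nonneg _).trans (hN 0)
  have e : ∏ i, N i - ∏ i, L i = (N 0 - L 0) * (N 1 * N 2 * N 3) + (N 1 - L 1) * (L 0 * N 2 * N 3) +
      (N 2 - L 2) * (L 0 * L 1 * N 3) + (N 3 - L 3) * (L 0 * L 1 * L 2) := by
    simp only [Fin.prod_univ_four]; ring
  have key : ∀ {d x y z : ℝ}, |d| ≤ 1 → |x| ≤ B → |y| ≤ B → |z| ≤ B →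
      |d * (x * y * z)| ≤ B ^ 3 := by
    intro d x y z hd hx hy hz
    rw [abs_mul, abs_mul, abs_mul]
    calc _ ≤ 1 * (B * B * B) := by gcongr
      _ = B ^ 3 := by ring
  rw [e]
  have h0 := key (hNL 0) (hN 1) (hN 2) (hN 3)
  have h1 := key (hNL 1) (hL 0) (hN 2) (hN 3)
  have h2 := key (hNL 2) (hL 0) (hL 1) (hN 3)
  have h3 := key (hNL 3) (hL 0) (hL 1) (hL 2)
  rw [abs_le] at *
  constructor <;> linarith

theorem abs_card_Icc_sub_le {x y : ℝ} (hxy : x ≤ y) :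
    |(#(Icc ⌈x⌉ ⌊y⌋) : ℝ) - (y - x)| ≤ 1 := by
  have h1 := Int.le_ceil x
  have h2 := Int.ceil_lt_add_one x
  have h3 := Int.floor_le y
  have h4 := Int.lt_floor_add_one y
  have h5 : ⌈x⌉ < ⌊y⌋ + 2 := by
    have : (⌈x⌉ : ℝ) < ((⌊y⌋ + 2 : ℤ) : ℝ) := by push_cast; linarith
    exact_mod_cast this
  have h6 : (#(Icc ⌈x⌉ ⌊y⌋) : ℝ) = ⌊y⌋ + 1 - ⌈x⌉ := by
    rw [Int.card_Icc, ← Int.cast_natCast, Int.toNat_of_nonneg (by omega)]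
    push_cast; ring
  rw [h6, abs_le]
  constructor <;> linarith

theorem sum_divisors_div_le {n : ℕ} (hn : Squarefree n) :
    (∑ d ∈ n.divisors, (d : ℝ)) / n ≤ #n.divisors := by
  have : (0 : ℝ) < n := Nat.cast_pos.2 (Nat.pos_of_ne_zero hn.ne_zero)
  rw [div_le_iff₀ this, ← nsmul_eq_mul]
  exact Finset.sum_le_card_nsmul _ _ _ fun d hd => by exact_mod_cast Nat.divisor_le hd

theorem finsum_wn_eq (n : ℕ) (α β : Fin 4 → ℝ) :
    ∑ᶠ v : { v : Fin 4 → ℤ // ∀ i, α i ≤ (v i : ℝ) ∧ (v i : ℝ) ≤ β i }, wn n v.1 =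
      ∑ v ∈ Fintype.piFinset fun i => Icc ⌈α i⌉ ⌊β i⌋, wn n v := by
  rw [finsum_subtype_eq_finsum_cond (f := wn n)]
  rw [← finsum_mem_coe_finset]
  refine finsum_congr fun v => ?_
  simp only [Finset.mem_coe, Fintype.mem_piFinset, Finset.mem_Icc, Int.ceil_le, Int.le_floor]

end Bounds

theorem roots_equidistributed_in_boxes (ε : ℝ) (hε : 0 < ε) :
    ∃ C : ℝ, ∀ n : ℕ, Squarefree n → ∀ α β : Fin 4 → ℝ,
      (∀ i, α i ≤ β i) → (∀ i, β i - α i ≤ (n : ℝ)) →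
      |((∑ᶠ v : { v : Fin 4 → ℤ // ∀ i, α i ≤ (v i : ℝ) ∧ (v i : ℝ) ≤ β i },
            wn n v.1 : ℕ) : ℝ) -
          ((∑ d ∈ n.divisors, (d : ℝ)) / (n : ℝ)) * ∏ i, (β i - α i)| ≤
        C * (n : ℝ) ^ ((3 : ℝ) + ε) := by
  have hδ : 0 < ε / 7 := by positivity
  obtain ⟨C₁, hC₁⟩ := exists_card_divisors_le_rpow (ε / 7) hδ
  set C₂ : ℝ := 1 + (ε / 7)⁻¹
  refine ⟨464 * (C₁ ^ 4 * C₂ ^ 3), fun n hn α β hαβ hlen => ?_⟩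
  have : NeZero n := ⟨hn.ne_zero⟩
  have hn1 : (1 : ℝ) ≤ n := by exact_mod_cast NeZero.one_le (n := n)
  have hcard : ∀ i, |(#(Icc ⌈α i⌉ ⌊β i⌋) : ℝ) - (β i - α i)| ≤ 1 := fun i =>
    abs_card_Icc_sub_le (hαβ i)
  have hN : ∀ i, (#(Icc ⌈α i⌉ ⌊β i⌋) : ℝ) ≤ 2 * n := fun i => by
    have := (abs_le.1 (hcard i)).2
    have := hlen i
    linarith
  have hvol := abs_prod_four_sub_le (N := fun i => (#(Icc ⌈α i⌉ ⌊β i⌋) : ℝ))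
    (L := fun i => β i - α i) (B := 2 * n) (fun i => by rw [Nat.abs_cast]; exact hN i)
    (fun i => by
      rw [abs_of_nonneg (sub_nonneg.2 (hαβ i))]
      have := hlen i
      linarith) hcard
  have hmain := abs_sum_wn_sub_le hn (a := fun i => ⌈α i⌉) (b := fun i => ⌊β i⌋) hN
  have hD := hC₁ n hn
  have hD1 : (1 : ℝ) ≤ #n.divisors := by
    exact_mod_cast Finset.card_pos.2 (Nat.nonempty_divisors.2 hn.ne_zero)
  have hσ := sum_divisors_div_le hn
  have hσ0 : 0 ≤ (∑ d ∈ n.divisors, (d : ℝ)) / n := by positivity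
  have hH := harmonic_le_one_add_log n
  have hH0 : (0 : ℝ) ≤ harmonic n := by
    exact_mod_cast (harmonic_pos (NeZero.ne n)).le
  have hlog := one_add_log_le_rpow hδ hn1
  have hlog1 : 1 ≤ 1 + Real.log n := by linarith [Real.log_nonneg hn1]
  rw [finsum_wn_eq, Nat.cast_sum]
  set W : ℝ := ∑ v ∈ Fintype.piFinset fun i => Icc ⌈α i⌉ ⌊β i⌋, (wn n v : ℝ)
  set D : ℝ := (#n.divisors : ℝ)
  set S : ℝ := (∑ d ∈ n.divisors, (d : ℝ)) / n
  set H : ℝ := 1 + Real.log n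
  set N : ℝ := ∏ i, (#(Icc ⌈α i⌉ ⌊β i⌋) : ℝ)
  set V : ℝ := ∏ i, (β i - α i)
  have hDH : 1 ≤ D * H := one_le_mul_of_one_le_of_one_le hD1 hlog1
  have hDD : D ≤ D * (D * H) ^ 3 := le_mul_of_one_le_right (by positivity) (one_le_pow₀ hDH)
  calc |W - S * V| = |(W - S * N) + S * (N - V)| := by ring_nf
    _ ≤ |W - S * N| + S * |N - V| := by
        refine (abs_add_le _ _).trans_eq ?_
        rw [abs_mul, abs_of_nonneg hσ0]
    _ ≤ 16 * n ^ 3 * (D * (1 + 2 * (D * harmonic n)) ^ 3) + D * (4 * (2 * n) ^ 3) := by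
        gcongr
    _ ≤ 16 * n ^ 3 * (D * (1 + 2 * (D * H)) ^ 3) + D * (4 * (2 * n) ^ 3) := by
        gcongr
    _ ≤ 16 * n ^ 3 * (D * (D * H + 2 * (D * H)) ^ 3) + D * (D * H) ^ 3 * (4 * (2 * n) ^ 3) := by
        gcongr
    _ = 464 * n ^ 3 * (D ^ 4 * H ^ 3) := by ring
    _ ≤ 464 * n ^ 3 * ((C₁ * (n : ℝ) ^ (ε / 7)) ^ 4 * (C₂ * (n : ℝ) ^ (ε / 7)) ^ 3) := by
        gcongr
    _ = 464 * (C₁ ^ 4 * C₂ ^ 3) * ((n : ℝ) ^ 3 * ((n : ℝ) ^ (ε / 7)) ^ 7) := by ring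
    _ = 464 * (C₁ ^ 4 * C₂ ^ 3) * (n : ℝ) ^ ((3 : ℝ) + ε) := by
        rw [← Real.rpow_natCast _ 7, ← Real.rpow_mul (by positivity),
          Real.rpow_add (by positivity), ← Real.rpow_natCast _ 3]
        norm_num
end
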